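/- Let (I_n) be the internal DLA process on the cylinder Z_N × Z started from I_0 = R_0, where at each step a simple random walk is started uniformly at random on level zero and the first exit location from the current cluster is added. For any γ > 0 and m ∈ N there exists a constant C = C(γ, m) such that, for N large enough, P[R_{n/N − C log N} ⊆ I_n ⊆ R_{n/N + C log N} for all n ≤ N^m] ≥ 1 − N^{−γ}. -/

import Mathlib

open MeasureTheory Filter Topology

open Classical in
/-- Probability that the random walk which at each step moves uniformly to one of the
points in `nbr ·`, started at `x`, hits the set `A` within `n` steps, with first
hitting position `y`. -/
noncomputable def hitP {V : Type*} (nbr : V → Finset V) (A : Set V) : ℕ → V → V → ℝ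
  | 0, x, y => if x ∈ A ∧ x = y then 1 else 0
  | n+1, x, y =>
      if x ∈ A then (if x = y then 1 else 0)
      else ((nbr x).card : ℝ)⁻¹ * ∑ z ∈ nbr x, hitP nbr A n z y

/-- The hitting distribution `H_A(x,y)`. -/
noncomputable def hitMeas {V : Type*} (nbr : V → Finset V) (A : Set V) (x y : V) : ℝ :=
  ⨆ n, hitP nbr A n x y

/-- Outer boundary of a (possibly infinite) set. -/
def bdryS {V : Type*} (nbr : V → Finset V) (A : Set V) : Set V :=
  {y | y ∉ A ∧ ∃ x ∈ A, y ∈ nbr x}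

/-- The neighbor function of the cylinder graph `ℤ_N × ℤ`. -/
def cylNbrZ {N : ℕ} (v : ZMod N × ℤ) : Finset (ZMod N × ℤ) :=
  {(v.1 + 1, v.2), (v.1 - 1, v.2), (v.1, v.2 + 1), (v.1, v.2 - 1)}

/-- The "rectangle" of (real) height `t` in the cylinder `ℤ_N × ℤ`. -/
def cylRect (N : ℕ) (t : ℝ) : Set (ZMod N × ℤ) := {v | (v.2 : ℝ) ≤ t}

/-- The average of `f` over the four lattice neighbours of a point of `R × ℤ`. -/
noncomputable def latticeAvg {R : Type*} [AddGroupWithOne R] (f : R × ℤ → ℝ) (v : R × ℤ) : ℝ :=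
  (f (v.1 + 1, v.2) + f (v.1 - 1, v.2) + f (v.1, v.2 + 1) + f (v.1, v.2 - 1)) / 4

/-- Adjacency in the lattice `R × ℤ`. -/
def latticeNbr {R : Type*} [AddGroupWithOne R] (v w : R × ℤ) : Prop :=
  w = (v.1 + 1, v.2) ∨ w = (v.1 - 1, v.2) ∨ w = (v.1, v.2 + 1) ∨ w = (v.1, v.2 - 1)

/-- The outer boundary of a subset of the lattice `R × ℤ`. -/
def latticeBdry {R : Type*} [AddGroupWithOne R] (D : Set (R × ℤ)) : Set (R × ℤ) :=
  {w | w ∉ D ∧ ∃ v ∈ D, latticeNbr v w}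

lemma latticeNbr_cases {R : Type*} [AddGroupWithOne R] {v : R × ℤ} {p : R × ℤ → Prop}
    (h : ∀ w, latticeNbr v w → p w) :
    p (v.1 + 1, v.2) ∧ p (v.1 - 1, v.2) ∧ p (v.1, v.2 + 1) ∧ p (v.1, v.2 - 1) :=
  ⟨h _ (Or.inl rfl), h _ (Or.inr (Or.inl rfl)), h _ (Or.inr (Or.inr (Or.inl rfl))),
    h _ (Or.inr (Or.inr (Or.inr rfl)))⟩

lemma latticeNbr.snd_le {R : Type*} [AddGroupWithOne R] {v w : R × ℤ} (h : latticeNbr v w) :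
    w.2 ≤ v.2 + 1 ∧ v.2 ≤ w.2 + 1 := by
  rcases h with rfl | rfl | rfl | rfl <;> constructor <;> simp <;> omega

lemma latticeAvg_add {R : Type*} [AddGroupWithOne R] (f g : R × ℤ → ℝ) (v : R × ℤ) :
    latticeAvg (fun w => f w + g w) v = latticeAvg f v + latticeAvg g v := by
  simp only [latticeAvg]; ring

lemma latticeAvg_sub {R : Type*} [AddGroupWithOne R] (f g : R × ℤ → ℝ) (v : R × ℤ) :
    latticeAvg (fun w => f w - g w) v = latticeAvg f v - latticeAvg g v := by
  simp only [latticeAvg]; ring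

lemma latticeAvg_const_mul {R : Type*} [AddGroupWithOne R] (c : ℝ) (g : R × ℤ → ℝ) (v : R × ℤ) :
    latticeAvg (fun w => c * g w) v = c * latticeAvg g v := by
  simp only [latticeAvg]; ring

lemma latticeAvg_const {R : Type*} [AddGroupWithOne R] (c : ℝ) (v : R × ℤ) :
    latticeAvg (fun _ => c) v = c := by
  simp only [latticeAvg]; ring

lemma latticeAvg_sum {R ι : Type*} [AddGroupWithOne R] (s : Finset ι) (f : ι → R × ℤ → ℝ)
    (v : R × ℤ) :
    latticeAvg (fun w => ∑ i ∈ s, f i w) v = ∑ i ∈ s, latticeAvg (f i) v := by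
  simp only [latticeAvg, ← Finset.sum_add_distrib, Finset.sum_div]

/-- Minimum principle for superharmonic functions on a finite set. -/
theorem nonneg_of_superharmonic_of_finite {R : Type*} [AddGroupWithOne R] {D : Set (R × ℤ)}
    (hD : D.Finite) {f : R × ℤ → ℝ} (hf : ∀ v ∈ D, latticeAvg f v ≤ f v)
    (hb : ∀ w ∈ latticeBdry D, 0 ≤ f w) : ∀ v ∈ D, 0 ≤ f v := by
  intro v₀ hv₀
  by_contra hneg
  push Not at hneg
  obtain ⟨v₁, hv₁, hmin⟩ := hD.exists_minimalFor f D ⟨v₀, hv₀⟩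
  have hmin' : ∀ v ∈ D, f v₁ ≤ f v := by
    intro v hv
    rcases le_total (f v₁) (f v) with h | h
    · exact h
    · exact hmin hv h
  have hm : f v₁ < 0 := (hmin' _ hv₀).trans_lt hneg
  have hD' : {v ∈ D | f v = f v₁}.Finite := hD.subset (fun v hv => hv.1)
  obtain ⟨v₂, hv₂, htop⟩ := hD'.exists_maximalFor (fun v => v.2) _ ⟨v₁, hv₁, rfl⟩
  have hnb : ∀ w, latticeNbr v₂ w → f v₂ ≤ f w := by
    intro w hw
    rw [hv₂.2]
    by_cases h : w ∈ D
    · exact hmin' w h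
    · exact hm.le.trans (hb w ⟨h, v₂, hv₂.1, hw⟩)
  obtain ⟨h1, h2, h3, h4⟩ := latticeNbr_cases hnb
  have havg := hf v₂ hv₂.1
  simp only [latticeAvg] at havg
  have h3' : f (v₂.1, v₂.2 + 1) = f v₁ := by rw [← hv₂.2]; linarith
  have hup : (v₂.1, v₂.2 + 1) ∈ D := by
    by_contra h
    have := hb _ ⟨h, v₂, hv₂.1, Or.inr (Or.inr (Or.inl rfl))⟩
    linarith
  have := htop (j := (v₂.1, v₂.2 + 1)) ⟨hup, h3'⟩ (by simp)
  simp at this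

lemma finite_snd_mem_Icc {N : ℕ} [NeZero N] (a b : ℤ) :
    {v : ZMod N × ℤ | a ≤ v.2 ∧ v.2 ≤ b}.Finite := by
  refine ((Set.finite_univ (α := ZMod N)).prod (Set.finite_Icc a b)).subset ?_
  intro v hv
  exact ⟨Set.mem_univ _, hv⟩

/-- Minimum principle for superharmonic functions that are bounded below, on a subset of the
cylinder whose height is bounded above. -/
theorem nonneg_of_superharmonic_of_bddBelow {N : ℕ} [NeZero N] {D : Set (ZMod N × ℤ)} {K : ℤ}
    (hK : ∀ v ∈ D, v.2 ≤ K) {f : ZMod N × ℤ → ℝ} {B : ℝ} (hB : ∀ v, -B ≤ f v)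
    (hf : ∀ v ∈ D, latticeAvg f v ≤ f v)
    (hb : ∀ w ∈ latticeBdry D, 0 ≤ f w) : ∀ v ∈ D, 0 ≤ f v := by
  intro v₀ hv₀
  have key : ∀ ε : ℝ, 0 < ε → 0 ≤ f v₀ + ε * (K + 1 - v₀.2) := by
    intro ε hε
    obtain ⟨n, hn⟩ := exists_nat_gt (B / ε)
    have hn' : B < n * ε := by rwa [div_lt_iff₀ hε] at hn
    set n' : ℤ := max (n + |K|) (-v₀.2) with hn'def
    have hn1 : n + |K| ≤ n' := le_max_left _ _
    have hn2 : -v₀.2 ≤ n' := le_max_right _ _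
    set D' : Set (ZMod N × ℤ) := {v | v ∈ D ∧ -n' ≤ v.2}
    have hfin : D'.Finite := (finite_snd_mem_Icc (-n') K).subset
      (fun v hv => ⟨hv.2, hK v hv.1⟩)
    refine nonneg_of_superharmonic_of_finite hfin
      (f := fun v => f v + ε * (K + 1 - v.2)) ?_ ?_ v₀ ⟨hv₀, by linarith⟩
    · intro v hv
      have := hf v hv.1
      simp only [latticeAvg] at this ⊢
      push_cast
      linarith
    · rintro w ⟨hw, v, hv, hvw⟩
      have hwK : w.2 ≤ K + 1 := by linarith [hvw.snd_le.1, hK v hv.1]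
      have hwK' : (w.2 : ℝ) ≤ K + 1 := by exact_mod_cast hwK
      by_cases hwD : w ∈ D
      · have hlow : w.2 < -n' := by
          by_contra h
          exact hw ⟨hwD, not_lt.mp h⟩
        have h1 : w.2 + n ≤ K := by
          have := neg_abs_le K
          linarith
        have h1' : (w.2 : ℝ) + n ≤ K := by exact_mod_cast h1
        have := hB w
        have : (n : ℝ) * ε ≤ ε * (K + 1 - w.2) := by
          rw [mul_comm]
          exact mul_le_mul_of_nonneg_left (by linarith) hε.le
        show 0 ≤ f w + ε * (K + 1 - w.2)
        linarith
      · have := hb w ⟨hwD, v, hv.1, hvw⟩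
        have := mul_nonneg hε.le (sub_nonneg.mpr hwK')
        show 0 ≤ f w + ε * (K + 1 - w.2)
        linarith
  have hK0 : (0 : ℝ) < K + 1 - v₀.2 := by
    have : (v₀.2 : ℝ) ≤ K := by exact_mod_cast hK v₀ hv₀
    linarith
  by_contra hneg
  push Not at hneg
  have := key (-f v₀ / (2 * (K + 1 - v₀.2))) (by apply div_pos <;> linarith)
  rw [div_mul_eq_mul_div, mul_div_mul_right _ _ hK0.ne'] at this
  linarith

lemma mem_cylNbrZ_iff {N : ℕ} {v w : ZMod N × ℤ} : w ∈ cylNbrZ v ↔ latticeNbr v w := by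
  simp [cylNbrZ, latticeNbr]

lemma bdryS_cylNbrZ {N : ℕ} (A : Set (ZMod N × ℤ)) : bdryS cylNbrZ A = latticeBdry A := by
  ext w
  simp [bdryS, latticeBdry, mem_cylNbrZ_iff]

lemma inv_card_mul_sum_cylNbrZ {N : ℕ} (hN : 3 ≤ N) (f : ZMod N × ℤ → ℝ) (v : ZMod N × ℤ) :
    ((cylNbrZ v).card : ℝ)⁻¹ * ∑ w ∈ cylNbrZ v, f w = latticeAvg f v := by
  have h1 : (1 : ZMod N) ≠ 0 := by
    have : Fact (1 < N) := ⟨by omega⟩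
    exact one_ne_zero
  have h2 : (2 : ZMod N) ≠ 0 := by
    intro h
    have : ((2 : ℕ) : ZMod N) = 0 := by exact_mod_cast h
    rw [ZMod.natCast_eq_zero_iff] at this
    have := Nat.le_of_dvd (by norm_num) this
    omega
  have hne : v.1 + 1 ≠ v.1 - 1 := by
    intro h
    apply h2
    linear_combination h
  have hA : (v.1 + 1, v.2) ∉
      ({(v.1 - 1, v.2), (v.1, v.2 + 1), (v.1, v.2 - 1)} : Finset (ZMod N × ℤ)) := by
    simp [hne, h1]
  have hB : (v.1 - 1, v.2) ∉ ({(v.1, v.2 + 1), (v.1, v.2 - 1)} : Finset (ZMod N × ℤ)) := by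
    simp [h1]
  have hC : (v.1, v.2 + 1) ∉ ({(v.1, v.2 - 1)} : Finset (ZMod N × ℤ)) := by
    simp; omega
  rw [cylNbrZ, Finset.card_insert_of_notMem hA, Finset.card_insert_of_notMem hB,
    Finset.card_insert_of_notMem hC, Finset.card_singleton, Finset.sum_insert hA,
    Finset.sum_insert hB, Finset.sum_insert hC, Finset.sum_singleton, latticeAvg]
  push_cast
  ring

section Hitting

variable {N : ℕ} (hN : 3 ≤ N) (B : Set (ZMod N × ℤ))

lemma hitP_of_mem {n : ℕ} {x : ZMod N × ℤ} (hx : x ∈ B) (y : ZMod N × ℤ) :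
    hitP cylNbrZ B n x y = if x = y then 1 else 0 := by
  cases n <;> simp [hitP, hx]

include hN in
lemma hitP_succ_of_notMem {n : ℕ} {x : ZMod N × ℤ} (hx : x ∉ B) (y : ZMod N × ℤ) :
    hitP cylNbrZ B (n + 1) x y = latticeAvg (fun z => hitP cylNbrZ B n z y) x := by
  rw [hitP, if_neg hx, inv_card_mul_sum_cylNbrZ hN]

include hN in
lemma hitP_mem_Icc (n : ℕ) (x y : ZMod N × ℤ) : hitP cylNbrZ B n x y ∈ Set.Icc (0 : ℝ) 1 := by
  induction n generalizing x with
  | zero => rw [hitP]; split_ifs <;> simp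
  | succ n ih =>
    by_cases hx : x ∈ B
    · rw [hitP_of_mem B hx]; split_ifs <;> simp
    · rw [hitP_succ_of_notMem hN B hx, latticeAvg]
      have h1 := ih (x.1 + 1, x.2)
      have h2 := ih (x.1 - 1, x.2)
      have h3 := ih (x.1, x.2 + 1)
      have h4 := ih (x.1, x.2 - 1)
      simp only [Set.mem_Icc] at *
      constructor <;> linarith

include hN in
lemma hitP_le_succ (n : ℕ) (x y : ZMod N × ℤ) :
    hitP cylNbrZ B n x y ≤ hitP cylNbrZ B (n + 1) x y := by
  induction n generalizing x with
  | zero =>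
    by_cases hx : x ∈ B
    · rw [hitP_of_mem B hx, hitP_of_mem B hx]
    · rw [hitP, if_neg (by tauto)]
      exact (hitP_mem_Icc hN B _ _ _).1
  | succ n ih =>
    by_cases hx : x ∈ B
    · rw [hitP_of_mem B hx, hitP_of_mem B hx]
    · rw [hitP_succ_of_notMem hN B hx, hitP_succ_of_notMem hN B hx, latticeAvg, latticeAvg]
      have h1 := ih (x.1 + 1, x.2)
      have h2 := ih (x.1 - 1, x.2)
      have h3 := ih (x.1, x.2 + 1)
      have h4 := ih (x.1, x.2 - 1)
      linarith

include hN in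
lemma tendsto_hitP (x y : ZMod N × ℤ) :
    Tendsto (fun n => hitP cylNbrZ B n x y) atTop (𝓝 (hitMeas cylNbrZ B x y)) := by
  refine tendsto_atTop_ciSup (monotone_nat_of_le_succ fun n => hitP_le_succ hN B n x y) ⟨1, ?_⟩
  rintro _ ⟨n, rfl⟩
  exact (hitP_mem_Icc hN B n x y).2

include hN in
lemma hitMeas_mem_Icc (x y : ZMod N × ℤ) : hitMeas cylNbrZ B x y ∈ Set.Icc (0 : ℝ) 1 :=
  isClosed_Icc.mem_of_tendsto (tendsto_hitP hN B x y)
    (Eventually.of_forall fun n => hitP_mem_Icc hN B n x y)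

include hN in
lemma hitMeas_of_mem {x : ZMod N × ℤ} (hx : x ∈ B) (y : ZMod N × ℤ) :
    hitMeas cylNbrZ B x y = if x = y then 1 else 0 := by
  refine tendsto_nhds_unique (tendsto_hitP hN B x y) ?_
  simp_rw [hitP_of_mem B hx]
  exact tendsto_const_nhds

include hN in
lemma hitMeas_of_notMem {x : ZMod N × ℤ} (hx : x ∉ B) (y : ZMod N × ℤ) :
    hitMeas cylNbrZ B x y = latticeAvg (fun z => hitMeas cylNbrZ B z y) x := by
  refine tendsto_nhds_unique ((tendsto_hitP hN B x y).comp (tendsto_add_atTop_nat 1)) ?_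
  simp only [Function.comp_def, hitP_succ_of_notMem hN B hx, latticeAvg]
  exact ((((tendsto_hitP hN B _ y).add (tendsto_hitP hN B _ y)).add
    (tendsto_hitP hN B _ y)).add (tendsto_hitP hN B _ y)).div_const 4

end Hitting

/-- The expectation of `f` at the exit point from `A` of a walk started at `x`; the finite set
`F` is meant to be the outer boundary of `A`. -/
noncomputable def exitMean {N : ℕ} (A : Set (ZMod N × ℤ)) (F : Finset (ZMod N × ℤ))
    (f : ZMod N × ℤ → ℝ) (x : ZMod N × ℤ) : ℝ :=
  ∑ y ∈ F, hitMeas cylNbrZ (bdryS cylNbrZ A) x y * f y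

section ExitMean

variable {N : ℕ} (hN : 3 ≤ N) {A : Set (ZMod N × ℤ)} {F : Finset (ZMod N × ℤ)}

include hN in
lemma exitMean_of_mem_bdry (hF : (F : Set (ZMod N × ℤ)) = latticeBdry A)
    (f : ZMod N × ℤ → ℝ) {x : ZMod N × ℤ} (hx : x ∈ latticeBdry A) :
    exitMean A F f x = f x := by
  have hxF : x ∈ F := by rw [← Finset.mem_coe, hF]; exact hx
  simp only [exitMean, bdryS_cylNbrZ, hitMeas_of_mem hN _ hx]
  simp [hxF]

include hN in
lemma latticeAvg_exitMean (f : ZMod N × ℤ → ℝ) {x : ZMod N × ℤ} (hx : x ∈ A) :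
    latticeAvg (exitMean A F f) x = exitMean A F f x := by
  have hx' : x ∉ bdryS cylNbrZ A := fun h => h.1 hx
  have : exitMean A F f =
      fun w => ∑ y ∈ F, f y * hitMeas cylNbrZ (bdryS cylNbrZ A) w y := by
    ext w; simp only [exitMean, mul_comm]
  rw [this, latticeAvg_sum]
  refine Finset.sum_congr rfl fun y _ => ?_
  rw [latticeAvg_const_mul, ← hitMeas_of_notMem hN _ hx']

include hN in
lemma abs_exitMean_le {f : ZMod N × ℤ → ℝ} {C : ℝ} (hC : ∀ v, |f v| ≤ C) (x : ZMod N × ℤ) :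
    |exitMean A F f x| ≤ F.card * C := by
  rw [exitMean, ← nsmul_eq_mul]
  refine (Finset.abs_sum_le_sum_abs _ _).trans (Finset.sum_le_card_nsmul _ _ _ fun y _ => ?_)
  have h := hitMeas_mem_Icc hN (bdryS cylNbrZ A) x y
  rw [abs_mul, abs_of_nonneg h.1]
  exact (mul_le_of_le_one_left (abs_nonneg _) h.2).trans (hC y)

include hN in
/-- Optional stopping: a bounded function which is subharmonic on `A` is at most its exit
mean. -/
theorem le_exitMean_of_subharmonic (hF : (F : Set (ZMod N × ℤ)) = latticeBdry A) {K : ℤ}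
    (hK : ∀ v ∈ A, v.2 ≤ K) {f : ZMod N × ℤ → ℝ} {C : ℝ} (hC : ∀ v, |f v| ≤ C)
    (hf : ∀ v ∈ A, f v ≤ latticeAvg f v) : ∀ x ∈ A, f x ≤ exitMean A F f x := by
  have : NeZero N := ⟨by omega⟩
  classical
  have hmain := nonneg_of_superharmonic_of_bddBelow hK
    (f := fun v => exitMean A F f v - f v) (B := F.card * C + C) ?_ ?_ ?_
  · intro x hx
    exact sub_nonneg.mp (hmain x hx)
  · intro v
    have h1 := neg_le_of_abs_le (abs_exitMean_le hN (A := A) (F := F) hC v)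
    have h2 := le_of_abs_le (hC v)
    linarith
  · intro v hv
    rw [latticeAvg_sub, latticeAvg_exitMean hN f hv]
    linarith [hf v hv]
  · intro w hw
    simp only [exitMean_of_mem_bdry hN hF f hw, sub_self, le_refl]

include hN in
lemma exitMean_one (hF : (F : Set (ZMod N × ℤ)) = latticeBdry A) {K : ℤ}
    (hK : ∀ v ∈ A, v.2 ≤ K) {x : ZMod N × ℤ} (hx : x ∈ A) :
    exitMean A F (fun _ => 1) x = 1 := by
  refine le_antisymm ?_ (le_exitMean_of_subharmonic hN hF hK (f := fun _ => 1) (C := 1)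
    (by simp) (by simp [latticeAvg_const]) x hx)
  have := le_exitMean_of_subharmonic hN hF hK (f := fun _ => -1) (C := 1)
    (by simp) (by simp [latticeAvg_const]) x hx
  simp only [exitMean, mul_neg, mul_one, Finset.sum_neg_distrib] at this ⊢
  linarith

include hN in
lemma exitMean_mono {f g : ZMod N × ℤ → ℝ} (h : ∀ y ∈ F, f y ≤ g y) (x : ZMod N × ℤ) :
    exitMean A F f x ≤ exitMean A F g x :=
  Finset.sum_le_sum fun y hy => mul_le_mul_of_nonneg_left (h y hy)
    (hitMeas_mem_Icc hN _ x y).1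

end ExitMean

/-- The real part of the standard additive character of `ℤ/N`. -/
noncomputable def cosChar {N : ℕ} [NeZero N] (j : ZMod N) : ℝ := (ZMod.stdAddChar j : ℂ).re

/-- The decay rate, away from the boundary of the half cylinder, of the harmonic function with
frequency `j`. -/
noncomputable def decayRate {N : ℕ} [NeZero N] (j : ZMod N) : ℝ :=
  (√(1 + √((1 - cosChar j) / 2) ^ 2) - √((1 - cosChar j) / 2)) ^ 2

/-- The Poisson kernel of the half cylinder, at depth `d` and horizontal displacement `x`. -/
noncomputable def cylPoisson {N : ℕ} [NeZero N] (d : ℕ) (x : ZMod N) : ℝ :=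
  (N : ℝ)⁻¹ * ∑ j : ZMod N, cosChar (x * j) * decayRate j ^ d

section CylPoisson

variable {N : ℕ} [NeZero N]

lemma abs_cosChar_le_one (j : ZMod N) : |cosChar j| ≤ 1 := by
  refine (Complex.abs_re_le_norm _).trans ?_
  rw [ZMod.stdAddChar_apply, Circle.norm_coe]

lemma cosChar_add_add_cosChar_sub (a b : ZMod N) :
    cosChar (a + b) + cosChar (a - b) = 2 * (cosChar a * cosChar b) := by
  rw [cosChar, cosChar, sub_eq_add_neg, AddChar.map_add_eq_mul, AddChar.map_add_eq_mul,
    AddChar.map_neg_eq_conj, cosChar, cosChar, Complex.mul_re, Complex.mul_re, Complex.conj_re,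
    Complex.conj_im]
  ring

lemma cosChar_zero : cosChar (0 : ZMod N) = 1 := by
  simp [cosChar]

lemma sum_cosChar_mul (b : ZMod N) :
    ∑ x : ZMod N, cosChar (x * b) = if b = 0 then (N : ℝ) else 0 := by
  simp only [cosChar, ← Complex.re_sum]
  rw [AddChar.sum_mulShift b (ZMod.isPrimitive_stdAddChar N), ZMod.card]
  split_ifs <;> simp

lemma decayRate_zero : decayRate (0 : ZMod N) = 1 := by
  simp [decayRate, cosChar_zero]

lemma decayRate_sq_add_one (j : ZMod N) :
    decayRate j ^ 2 + 1 = (4 - 2 * cosChar j) * decayRate j := by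
  have h1 := (abs_le.mp (abs_cosChar_le_one j)).2
  rw [decayRate]
  set s := √((1 - cosChar j) / 2) with hs
  have hs2 : s ^ 2 = (1 - cosChar j) / 2 := Real.sq_sqrt (by linarith)
  have ht2 : √(1 + s ^ 2) ^ 2 = 1 + s ^ 2 := Real.sq_sqrt (by positivity)
  set t := √(1 + s ^ 2)
  have hc : cosChar j = 1 - 2 * s ^ 2 := by linarith
  rw [hc]
  have h4 : t ^ 4 = (1 + s ^ 2) ^ 2 := by rw [← ht2]; ring
  have h3 : t ^ 3 = (1 + s ^ 2) * t := by rw [← ht2]; ring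
  linear_combination h4 - 4 * s * h3 + (6 * s ^ 2 - (4 - 2 * (1 - 2 * s ^ 2))) * ht2

lemma decayRate_pow_le (j : ZMod N) (d : ℕ) :
    decayRate j ^ d ≤ 1 / (1 + d * √((1 - cosChar j) / 2)) ^ 2 := by
  rw [decayRate]
  set s := √((1 - cosChar j) / 2) with hs
  have hs0 : 0 ≤ s := Real.sqrt_nonneg _
  have ht2 : √(1 + s ^ 2) ^ 2 = 1 + s ^ 2 := Real.sq_sqrt (by positivity)
  have ht1 : 1 ≤ √(1 + s ^ 2) := Real.one_le_sqrt.mpr (by nlinarith)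
  set t := √(1 + s ^ 2)
  have hq : t - s ≤ 1 / (1 + s) := by
    rw [le_div_iff₀ (by linarith)]
    nlinarith
  have hq0 : 0 ≤ t - s := by nlinarith
  have hb : 1 + (d : ℝ) * s ≤ (1 + s) ^ d := one_add_mul_le_pow (by linarith) d
  calc ((t - s) ^ 2) ^ d = ((t - s) ^ d) ^ 2 := by rw [← pow_mul, ← pow_mul, mul_comm]
    _ ≤ ((1 / (1 + s)) ^ d) ^ 2 := by gcongr
    _ = 1 / ((1 + s) ^ d) ^ 2 := by rw [div_pow, one_pow, div_pow, one_pow]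
    _ ≤ 1 / (1 + d * s) ^ 2 := by gcongr

lemma decayRate_nonneg (j : ZMod N) : 0 ≤ decayRate j := sq_nonneg _

lemma decayRate_le_one (j : ZMod N) : decayRate j ≤ 1 := by
  have h := decayRate_pow_le j 1
  rw [pow_one] at h
  refine h.trans ?_
  rw [div_le_one (by positivity)]
  have : 0 ≤ √((1 - cosChar j) / 2) := Real.sqrt_nonneg _
  push_cast
  nlinarith

lemma le_sqrt_cosChar (j : ZMod N) :
    2 * (j.val : ℝ) / N ≤ √((1 - cosChar j) / 2) ∨
      2 * ((N : ℝ) - j.val) / N ≤ √((1 - cosChar j) / 2) := by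
  have hN : (0 : ℝ) < N := by exact_mod_cast Nat.pos_of_ne_zero (NeZero.ne N)
  have hval : (j.val : ℝ) ≤ N := by exact_mod_cast (ZMod.val_lt j).le
  set φ : ℝ := Real.pi * (j.val / N) with hφ
  have hcos : cosChar j = Real.cos (2 * φ) := by
    rw [cosChar, ZMod.stdAddChar_apply, ZMod.toCircle_eq_circleExp, Circle.coe_exp,
      Complex.exp_ofReal_mul_I_re]
    congr 1
    rw [hφ]; ring
  have hφ0 : 0 ≤ φ := by positivity
  have hφπ : φ ≤ Real.pi := by
    rw [hφ]
    exact mul_le_of_le_one_right Real.pi_pos.le ((div_le_one hN).mpr hval)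
  have hsin : √((1 - cosChar j) / 2) = Real.sin φ := by
    rw [hcos, Real.cos_two_mul, Real.cos_sq']
    rw [show (1 - (2 * (1 - Real.sin φ ^ 2) - 1)) / 2 = Real.sin φ ^ 2 by ring]
    exact Real.sqrt_sq (Real.sin_nonneg_of_nonneg_of_le_pi hφ0 hφπ)
  rw [hsin]
  rcases le_total φ (Real.pi / 2) with h | h
  · left
    refine le_trans (le_of_eq ?_) (Real.mul_le_sin hφ0 h)
    rw [hφ]
    field_simp
  · right
    rw [← Real.sin_pi_sub]
    refine le_trans (le_of_eq ?_) (Real.mul_le_sin (by linarith) (by linarith))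
    rw [hφ]
    field_simp

lemma sum_inv_sq_le {β : ℝ} (hβ : 0 < β) (n : ℕ) :
    ∑ i ∈ Finset.range n, 1 / (1 + β * ((i : ℝ) + 1)) ^ 2 ≤ 1 / (β * (1 + β / 2)) := by
  have key : ∑ i ∈ Finset.range n, 1 / (1 + β * ((i : ℝ) + 1)) ^ 2 ≤
      1 / (β * (1 + β / 2)) - 1 / (β * (1 + β * (n + 1 / 2))) := by
    induction n with
    | zero => 
      simp only [Finset.range_zero, Finset.sum_empty, Nat.cast_zero]
      apply le_of_eq
      rw [eq_comm, sub_eq_zero]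
      congr 3
      ring
    | succ n ih =>
      rw [Finset.sum_range_succ]
      have hn : (0 : ℝ) ≤ n := Nat.cast_nonneg n
      have h : 1 / (1 + β * ((n : ℝ) + 1)) ^ 2 ≤ 1 / (β * (1 + β * (n + 1 / 2))) -
          1 / (β * (1 + β * ((n + 1 : ℕ) + 1 / 2))) := by
        push_cast
        rw [div_sub_div _ _ (by positivity) (by positivity),
          div_le_div_iff₀ (by positivity) (by positivity)]
        have : 0 < β ^ 4 := by positivity
        nlinarith
      linarith
  refine key.trans (sub_le_self _ (by positivity))

lemma sum_zmod_eq_sum_range {M : Type*} [AddCommMonoid M] (f : ℕ → M) :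
    ∑ j : ZMod N, f j.val = ∑ i ∈ Finset.range N, f i := by
  refine Finset.sum_bij' (fun j _ => j.val) (fun i _ => (i : ZMod N)) ?_ ?_ ?_ ?_ ?_
  · intro j _; exact Finset.mem_range.mpr (ZMod.val_lt j)
  · intro i _; exact Finset.mem_univ _
  · intro j _; exact ZMod.natCast_zmod_val j
  · intro i hi; exact ZMod.val_cast_of_lt (Finset.mem_range.mp hi)
  · intro j _; rfl

lemma abs_cylPoisson_sub_le {d : ℕ} (hd : 1 ≤ d) (x : ZMod N) :
    |cylPoisson d x - 1 / N| ≤ 1 / d - 1 / (d + N) := by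
  have hNpos : 0 < N := Nat.pos_of_ne_zero (NeZero.ne N)
  have hN : (0 : ℝ) < N := by exact_mod_cast hNpos
  have hd' : (0 : ℝ) < d := by exact_mod_cast hd
  set β : ℝ := 2 * d / N with hβdef
  have hβ : 0 < β := by positivity
  have hsplit : cylPoisson d x - 1 / N =
      (N : ℝ)⁻¹ * ∑ j ∈ Finset.univ.erase (0 : ZMod N), cosChar (x * j) * decayRate j ^ d := by
    rw [cylPoisson, ← Finset.add_sum_erase _ _ (Finset.mem_univ (0 : ZMod N)), mul_zero,
      cosChar_zero, decayRate_zero, one_pow]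
    ring
  have hterm : ∀ j ∈ Finset.univ.erase (0 : ZMod N), |cosChar (x * j) * decayRate j ^ d| ≤
      1 / (1 + β * j.val) ^ 2 + 1 / (1 + β * ((N : ℝ) - j.val)) ^ 2 := by
    intro j _
    have hval : (j.val : ℝ) ≤ N := by exact_mod_cast (ZMod.val_lt j).le
    have hv0 : (0 : ℝ) ≤ j.val := Nat.cast_nonneg _
    rw [abs_mul, abs_of_nonneg (pow_nonneg (decayRate_nonneg j) d)]
    refine (mul_le_of_le_one_left (pow_nonneg (decayRate_nonneg j) d)
      (abs_cosChar_le_one _)).trans ((decayRate_pow_le j d).trans ?_)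
    rcases le_sqrt_cosChar j with h | h
    · refine le_add_of_le_of_nonneg ?_ (by positivity)
      have : β * j.val ≤ d * √((1 - cosChar j) / 2) := by
        calc β * j.val = d * (2 * (j.val : ℝ) / N) := by rw [hβdef]; ring
          _ ≤ _ := by gcongr
      gcongr
    · refine le_add_of_nonneg_of_le (by positivity) ?_
      have h0 : 0 ≤ β * ((N : ℝ) - j.val) := mul_nonneg hβ.le (by linarith)
      have : β * ((N : ℝ) - j.val) ≤ d * √((1 - cosChar j) / 2) := by
        calc β * ((N : ℝ) - j.val) = d * (2 * ((N : ℝ) - j.val) / N) := by rw [hβdef]; ring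
          _ ≤ _ := by gcongr
      gcongr
  have hsum : ∑ j ∈ Finset.univ.erase (0 : ZMod N),
      (1 / (1 + β * j.val) ^ 2 + 1 / (1 + β * ((N : ℝ) - j.val)) ^ 2) ≤
      2 * (1 / (β * (1 + β / 2))) := by
    have e1 : ∑ j ∈ Finset.univ.erase (0 : ZMod N),
        (1 / (1 + β * j.val) ^ 2 + 1 / (1 + β * ((N : ℝ) - j.val)) ^ 2) =
        ∑ i ∈ Finset.range (N - 1), (1 / (1 + β * ((i : ℝ) + 1)) ^ 2 +
          1 / (1 + β * ((N : ℝ) - (i + 1))) ^ 2) := by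
      set g : ℕ → ℝ :=
        fun i => 1 / (1 + β * (i : ℝ)) ^ 2 + 1 / (1 + β * ((N : ℝ) - i)) ^ 2 with hg
      have hr : ∑ i ∈ Finset.range N, g i = ∑ i ∈ Finset.range (N - 1), g (i + 1) + g 0 := by
        rw [← Finset.sum_range_succ', Nat.sub_add_cancel hNpos]
      have hz := sum_zmod_eq_sum_range (N := N) g
      rw [← Finset.add_sum_erase _ _ (Finset.mem_univ (0 : ZMod N)), hr, add_comm,
        ZMod.val_zero] at hz
      have hz' := add_right_cancel hz
      simp only [hg] at hz'
      push_cast at hz'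
      exact hz'
    rw [e1, Finset.sum_add_distrib, two_mul]
    refine add_le_add (sum_inv_sq_le hβ _) ?_
    rw [← Finset.sum_range_reflect]
    refine le_trans (le_of_eq (Finset.sum_congr rfl fun i hi => ?_)) (sum_inv_sq_le hβ (N - 1))
    have hi' := Finset.mem_range.mp hi
    have : ((N - 1 - 1 - i : ℕ) : ℝ) = (N : ℝ) - 2 - i := by
      rw [show N - 1 - 1 - i = N - (2 + i) by omega, Nat.cast_sub (by omega)]
      push_cast; ring
    rw [this]
    ring
  rw [hsplit, abs_mul, abs_of_pos (inv_pos.mpr hN)]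
  calc (N : ℝ)⁻¹ * |∑ j ∈ Finset.univ.erase (0 : ZMod N), cosChar (x * j) * decayRate j ^ d|
      ≤ (N : ℝ)⁻¹ * (2 * (1 / (β * (1 + β / 2)))) := by
        refine mul_le_mul_of_nonneg_left ?_ (inv_pos.mpr hN).le
        exact (Finset.abs_sum_le_sum_abs _ _).trans ((Finset.sum_le_sum hterm).trans hsum)
    _ = 1 / d - 1 / (d + N) := by
        rw [hβdef]
        field_simp
        ring

lemma abs_cylPoisson_le_one (d : ℕ) (x : ZMod N) : |cylPoisson d x| ≤ 1 := by
  have hN : (0 : ℝ) < N := by exact_mod_cast Nat.pos_of_ne_zero (NeZero.ne N)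
  rw [cylPoisson, abs_mul, abs_of_pos (inv_pos.mpr hN), inv_mul_le_iff₀ hN, mul_one]
  refine (Finset.abs_sum_le_sum_abs _ _).trans ?_
  refine (Finset.sum_le_card_nsmul _ _ 1 fun j _ => ?_).trans (by simp)
  rw [abs_mul, abs_of_nonneg (pow_nonneg (decayRate_nonneg j) d)]
  exact mul_le_one₀ (abs_cosChar_le_one _) (pow_nonneg (decayRate_nonneg j) d)
    (pow_le_one₀ (decayRate_nonneg j) (decayRate_le_one j))

lemma cylPoisson_zero (x : ZMod N) : cylPoisson 0 x = if x = 0 then 1 else 0 := by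
  have hN : (N : ℝ) ≠ 0 := by exact_mod_cast NeZero.ne N
  simp only [cylPoisson, pow_zero, mul_one, mul_comm x]
  rw [show (∑ j : ZMod N, cosChar (j * x)) = if x = 0 then (N : ℝ) else 0 from
    sum_cosChar_mul x]
  split_ifs <;> simp [hN]

lemma sum_cylPoisson (d : ℕ) : ∑ x : ZMod N, cylPoisson d x = 1 := by
  have hN : (N : ℝ) ≠ 0 := by exact_mod_cast NeZero.ne N
  simp only [cylPoisson]
  rw [← Finset.mul_sum, Finset.sum_comm]
  simp only [← Finset.sum_mul, sum_cosChar_mul]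
  simp [decayRate_zero, hN]

lemma cylPoisson_harmonic (d : ℕ) (x : ZMod N) :
    cylPoisson (d + 1) (x + 1) + cylPoisson (d + 1) (x - 1) + cylPoisson d x +
      cylPoisson (d + 2) x = 4 * cylPoisson (d + 1) x := by
  simp only [cylPoisson]
  rw [← mul_add, ← mul_add, ← mul_add, mul_left_comm 4, ← Finset.sum_add_distrib,
    ← Finset.sum_add_distrib, ← Finset.sum_add_distrib, Finset.mul_sum (a := (4 : ℝ))]
  congr 1
  refine Finset.sum_congr rfl fun j _ => ?_
  have h1 := cosChar_add_add_cosChar_sub (x * j) j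
  have h2 := decayRate_sq_add_one j
  rw [show (x + 1) * j = x * j + j by ring, show (x - 1) * j = x * j - j by ring]
  rw [show decayRate j ^ (d + 2) = decayRate j ^ d * decayRate j ^ 2 by ring, pow_succ]
  linear_combination decayRate j ^ d * decayRate j * h1 +
    cosChar (x * j) * decayRate j ^ d * h2

end CylPoisson

/-- The harmonic measure of `(x₀, k)` for the walk on the part of the cylinder below level `k`,
extended by zero above that level. -/
noncomputable def levelPoisson {N : ℕ} [NeZero N] (k : ℤ) (x₀ : ZMod N) (v : ZMod N × ℤ) : ℝ :=
  if v.2 ≤ k then cylPoisson (k - v.2).toNat (v.1 - x₀) else 0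

section LevelPoisson

variable {N : ℕ} [NeZero N] {k : ℤ} {x₀ : ZMod N}

lemma levelPoisson_sub (d : ℕ) (x : ZMod N) :
    levelPoisson k x₀ (x, k - d) = cylPoisson d (x - x₀) := by
  simp [levelPoisson]

lemma exists_eq_sub_of_le {y : ℤ} (h : y ≤ k) : ∃ d : ℕ, y = k - d :=
  ⟨(k - y).toNat, by omega⟩

lemma abs_levelPoisson_le_one (v : ZMod N × ℤ) : |levelPoisson k x₀ v| ≤ 1 := by
  rw [levelPoisson]
  split_ifs
  · exact abs_cylPoisson_le_one _ _
  · simp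

lemma levelPoisson_level (x : ZMod N) :
    levelPoisson k x₀ (x, k) = if x = x₀ then 1 else 0 := by
  have := levelPoisson_sub (k := k) (x₀ := x₀) 0 x
  simp only [Nat.cast_zero, sub_zero] at this
  rw [this, cylPoisson_zero]
  simp only [sub_eq_zero]

lemma levelPoisson_of_lt {v : ZMod N × ℤ} (h : k < v.2) : levelPoisson k x₀ v = 0 :=
  if_neg (not_le.mpr h)

lemma latticeAvg_levelPoisson {v : ZMod N × ℤ} (hv : v.2 < k) :
    latticeAvg (levelPoisson k x₀) v = levelPoisson k x₀ v := by
  obtain ⟨x, y⟩ := v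
  obtain ⟨d, hd⟩ := exists_eq_sub_of_le (show y ≤ k - 1 by simp at hv; omega)
  have h0 : y = k - (d + 1 : ℕ) := by rw [hd]; push_cast; ring
  have h1 : y + 1 = k - (d : ℕ) := by rw [hd]; ring
  have h2 : y - 1 = k - (d + 2 : ℕ) := by rw [hd]; push_cast; ring
  simp only [latticeAvg]
  rw [h1, h2, h0]
  simp only [levelPoisson_sub]
  have := cylPoisson_harmonic d (x - x₀)
  rw [show x + 1 - x₀ = x - x₀ + 1 by ring, show x - 1 - x₀ = x - x₀ - 1 by ring]
  linarith

lemma levelPoisson_nonneg (v : ZMod N × ℤ) : 0 ≤ levelPoisson k x₀ v := by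
  have hge : ∀ w : ZMod N × ℤ, k ≤ w.2 → 0 ≤ levelPoisson k x₀ w := by
    rintro ⟨x, y⟩ hw
    rcases hw.eq_or_lt with h | h
    · simp only at h
      rw [← h, levelPoisson_level]
      split_ifs <;> simp
    · rw [levelPoisson_of_lt h]
  rcases lt_or_ge v.2 k with hv | hv
  · refine nonneg_of_superharmonic_of_bddBelow (D := {v | v.2 < k}) (K := k) (B := 1)
      (fun v hv => le_of_lt hv) (fun v => neg_le_of_abs_le (abs_levelPoisson_le_one v))
      (fun v hv => (latticeAvg_levelPoisson hv).le) ?_ v hv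
    intro w hw
    exact hge w (not_lt.mp hw.1)
  · exact hge v hv

lemma levelPoisson_le_one (v : ZMod N × ℤ) : levelPoisson k x₀ v ≤ 1 :=
  le_of_abs_le (abs_levelPoisson_le_one v)

lemma sum_levelPoisson {y : ℤ} (hy : y ≤ k) : ∑ x : ZMod N, levelPoisson k x₀ (x, y) = 1 := by
  obtain ⟨d, rfl⟩ := exists_eq_sub_of_le hy
  simp only [levelPoisson_sub]
  rw [← sum_cylPoisson (N := N) d]
  exact Equiv.sum_comp (Equiv.subRight x₀) (fun x => cylPoisson d x)

lemma levelPoisson_le_latticeAvg {v : ZMod N × ℤ} (hv : v ≠ (x₀, k)) :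
    levelPoisson k x₀ v ≤ latticeAvg (levelPoisson k x₀) v := by
  rcases lt_or_ge v.2 k with h | h
  · exact (latticeAvg_levelPoisson h).ge
  · have h0 : levelPoisson k x₀ v = 0 := by
      rcases h.eq_or_lt with h | h
      · obtain ⟨x, y⟩ := v
        simp only at h
        rw [← h, levelPoisson_level, if_neg]
        rintro rfl
        exact hv (by rw [h])
      · exact levelPoisson_of_lt h
    rw [h0, latticeAvg]
    have := levelPoisson_nonneg (k := k) (x₀ := x₀)
    have h1 := this (v.1 + 1, v.2)
    have h2 := this (v.1 - 1, v.2)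
    have h3 := this (v.1, v.2 + 1)
    have h4 := this (v.1, v.2 - 1)
    linarith

end LevelPoisson

/-- A bound for the oscillation of the Poisson kernel at depth `d`. -/
noncomputable def oscBound (N : ℕ) (d : ℤ) : ℝ :=
  if 1 ≤ d then 1 / d - 1 / (d + N) else 1

lemma oscBound_nonneg (N : ℕ) (d : ℤ) : 0 ≤ oscBound N d := by
  rw [oscBound]
  split_ifs with h
  · have : (1 : ℝ) ≤ d := by exact_mod_cast h
    rw [sub_nonneg]
    gcongr
    simp
  · simp

lemma oscBound_anti (N : ℕ) {d e : ℤ} (h : d ≤ e) : oscBound N e ≤ oscBound N d := by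
  rw [oscBound, oscBound]
  have hN : (0 : ℝ) ≤ N := Nat.cast_nonneg N
  by_cases hd : 1 ≤ d
  · rw [if_pos hd, if_pos (hd.trans h)]
    have h1 : (1 : ℝ) ≤ d := by exact_mod_cast hd
    have h2 : (d : ℝ) ≤ e := by exact_mod_cast h
    have h0 : (0 : ℝ) < d := by linarith
    have h3 : (0 : ℝ) < e := by linarith
    rw [div_sub_div _ _ (by positivity) (by positivity), div_sub_div _ _ (by positivity)
      (by positivity), div_le_div_iff₀ (by positivity) (by positivity)]
    have : (d : ℝ) * (d + N) ≤ e * (e + N) := by gcongr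
    nlinarith
  · rw [if_neg hd]
    split_ifs with he
    · have h1 : (1 : ℝ) ≤ e := by exact_mod_cast he
      have : 1 / (e : ℝ) ≤ 1 := by rw [div_le_one (by linarith)]; exact h1
      have : 0 ≤ 1 / ((e : ℝ) + N) := by positivity
      linarith
    · exact le_rfl

lemma oscBound_le_one (N : ℕ) (d : ℤ) : oscBound N d ≤ 1 := by
  have := oscBound_anti N (min_le_left d 0)
  refine this.trans (le_of_eq ?_)
  rw [oscBound, if_neg]
  have := min_le_right d 0
  omega

lemma abs_levelPoisson_sub_le {N : ℕ} [NeZero N] {k : ℤ} {x₀ : ZMod N} (v : ZMod N × ℤ) :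
    |levelPoisson k x₀ v - 1 / N| ≤ oscBound N (k - v.2) := by
  obtain ⟨x, y⟩ := v
  rw [oscBound]
  split_ifs with h
  · obtain ⟨d, rfl⟩ := exists_eq_sub_of_le (show y ≤ k by simp at h; omega)
    rw [levelPoisson_sub]
    have := abs_cylPoisson_sub_le (d := d) (by simp at h; omega) (x - x₀)
    simpa using this
  · have hN : (1 : ℝ) ≤ N := by exact_mod_cast Nat.pos_of_ne_zero (NeZero.ne N)
    have h1 := levelPoisson_nonneg (k := k) (x₀ := x₀) (x, y)
    have h2 := levelPoisson_le_one (k := k) (x₀ := x₀) (x, y)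
    have h3 : 1 / (N : ℝ) ≤ 1 := by rw [div_le_one (by linarith)]; exact hN
    have h4 : 0 ≤ 1 / (N : ℝ) := by positivity
    rw [abs_le]
    constructor <;> linarith

lemma sum_oscBound_le {N : ℕ} (hN : 1 ≤ N) (D : ℕ) :
    ∑ d ∈ Finset.range D, oscBound N (d + 1) ≤ 1 + Real.log N := by
  set g : ℕ → ℝ := fun i => 1 / ((i : ℝ) + 1) with hg
  have hg0 : ∀ i, 0 ≤ g i := fun i => by positivity
  have h1 : ∀ d ∈ Finset.range D, oscBound N (d + 1) = g d - g (N + d) := by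
    intro d _
    rw [oscBound, if_pos (by omega), hg]
    push_cast
    ring
  have h2 : ∑ i ∈ Finset.range (N + D), g i =
      ∑ i ∈ Finset.range N, g i + ∑ i ∈ Finset.range D, g (N + i) :=
    Finset.sum_range_add g N D
  have h3 : ∑ i ∈ Finset.range D, g i ≤ ∑ i ∈ Finset.range (N + D), g i :=
    Finset.sum_le_sum_of_subset_of_nonneg (Finset.range_mono (by omega)) fun i _ _ => hg0 i
  have h4 : ∑ i ∈ Finset.range N, g i ≤ 1 + Real.log N := by
    refine le_trans (le_of_eq ?_) (harmonic_le_one_add_log N)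
    rw [harmonic]
    push_cast
    simp [hg]
  rw [Finset.sum_congr rfl h1, Finset.sum_sub_distrib]
  linarith

/-- The average of the functions `levelPoisson k (x₀ + i)` over `|i| ≤ M`. -/
noncomputable def smearedPoisson {N : ℕ} [NeZero N] (M : ℕ) (k : ℤ) (x₀ : ZMod N)
    (v : ZMod N × ℤ) : ℝ :=
  (2 * M + 1 : ℝ)⁻¹ * ∑ i ∈ Finset.Icc (-M : ℤ) M, levelPoisson k (x₀ + (i : ZMod N)) v

section SmearedPoisson

variable {N : ℕ} [NeZero N] {M : ℕ} {k : ℤ} {x₀ : ZMod N}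

lemma inv_mul_sum_Icc_const (M : ℕ) (c : ℝ) :
    (2 * M + 1 : ℝ)⁻¹ * ∑ _i ∈ Finset.Icc (-M : ℤ) M, c = c := by
  have : ((M : ℤ) + 1 - -(M : ℤ)).toNat = 2 * M + 1 := by omega
  rw [Finset.sum_const, Int.card_Icc, this, nsmul_eq_mul]
  push_cast
  field_simp

lemma latticeAvg_smearedPoisson {v : ZMod N × ℤ} (hv : v.2 < k) :
    latticeAvg (smearedPoisson M k x₀) v = smearedPoisson M k x₀ v := by
  have : smearedPoisson M k x₀ = fun v => (2 * M + 1 : ℝ)⁻¹ *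
    ∑ i ∈ Finset.Icc (-M : ℤ) M, levelPoisson k (x₀ + (i : ZMod N)) v := rfl
  rw [this, latticeAvg_const_mul, latticeAvg_sum]
  simp only [latticeAvg_levelPoisson hv]

lemma smearedPoisson_nonneg (v : ZMod N × ℤ) : 0 ≤ smearedPoisson M k x₀ v :=
  mul_nonneg (by positivity) (Finset.sum_nonneg fun _ _ => levelPoisson_nonneg _)

lemma smearedPoisson_le_one (v : ZMod N × ℤ) : smearedPoisson M k x₀ v ≤ 1 := by
  rw [← inv_mul_sum_Icc_const M 1]
  exact mul_le_mul_of_nonneg_left (Finset.sum_le_sum fun i _ => levelPoisson_le_one v)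
    (by positivity)

lemma sum_smearedPoisson {y : ℤ} (hy : y ≤ k) :
    ∑ x : ZMod N, smearedPoisson M k x₀ (x, y) = 1 := by
  simp only [smearedPoisson]
  rw [← Finset.mul_sum, Finset.sum_comm]
  simp only [sum_levelPoisson hy]
  exact inv_mul_sum_Icc_const M 1

lemma abs_smearedPoisson_sub_le (v : ZMod N × ℤ) :
    |smearedPoisson M k x₀ v - 1 / N| ≤ oscBound N (k - v.2) := by
  rw [← inv_mul_sum_Icc_const M (1 / (N : ℝ)), ← inv_mul_sum_Icc_const M (oscBound N (k - v.2)),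
    smearedPoisson, ← mul_sub, ← Finset.sum_sub_distrib, abs_mul,
    abs_of_nonneg (by positivity : (0 : ℝ) ≤ (2 * M + 1 : ℝ)⁻¹)]
  refine mul_le_mul_of_nonneg_left ?_ (by positivity)
  exact (Finset.abs_sum_le_sum_abs _ _).trans
    (Finset.sum_le_sum fun i _ => abs_levelPoisson_sub_le v)

lemma one_le_smearedPoisson_level {i : ℤ} (hi : |i| ≤ M) :
    1 ≤ (2 * M + 1) * smearedPoisson M k x₀ (x₀ + i, k) := by
  rw [smearedPoisson, ← mul_assoc, mul_inv_cancel₀ (by positivity), one_mul]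
  have hmem : i ∈ Finset.Icc (-M : ℤ) M := Finset.mem_Icc.mpr (abs_le.mp hi)
  refine le_trans (le_of_eq ?_)
    (Finset.single_le_sum (f := fun j : ℤ => levelPoisson k (x₀ + (j : ZMod N)) (x₀ + (i : ZMod N), k))
      (fun j _ => levelPoisson_nonneg _) hmem)
  simp [levelPoisson_level]

lemma sub_le_smearedPoisson (hM : 0 < M) {i y : ℤ} (hi : |i| < M) (hy : -M < y) (hy0 : y ≤ 0) :
    1 - ((i : ℝ) ^ 2 - y ^ 2) / M ^ 2 + 2 * y / M ≤
      (2 * M + 1) * smearedPoisson M k x₀ (x₀ + i, k + y) := by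
  have hM' : (0 : ℝ) < M := by exact_mod_cast hM
  set ψ : ℤ × ℤ → ℝ := fun v => 1 - ((v.1 : ℝ) ^ 2 - v.2 ^ 2) / M ^ 2 + 2 * v.2 / M with hψ
  set f : ℤ × ℤ → ℝ := fun v =>
    (2 * M + 1) * smearedPoisson M k x₀ (x₀ + v.1, k + v.2) - ψ v with hf
  have hnn : ∀ v, 0 ≤ (2 * M + 1 : ℝ) * smearedPoisson M k x₀ v :=
    fun v => mul_nonneg (by positivity) (smearedPoisson_nonneg v)
  have hlevel : ∀ j : ℤ, |j| ≤ M → 0 ≤ f (j, 0) := by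
    intro j hj
    have := one_le_smearedPoisson_level (k := k) (x₀ := x₀) hj
    have h2 : 0 ≤ (j : ℝ) ^ 2 / M ^ 2 := by positivity
    simp only [hf, hψ, add_zero, Int.cast_zero]
    ring_nf at this h2 ⊢
    linarith
  have main : 0 ≤ f (i, y) := by
    rcases hy0.eq_or_lt with rfl | hy0
    · exact hlevel i hi.le
    · have hfin : {v : ℤ × ℤ | |v.1| < M ∧ -M < v.2 ∧ v.2 < 0}.Finite := by
        refine ((Set.finite_Icc (-M : ℤ) M).prod (Set.finite_Icc (-M : ℤ) 0)).subset ?_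
        rintro ⟨a, b⟩ ⟨h1, h2, h3⟩
        simp only [abs_lt] at h1
        simp only [Set.mem_prod, Set.mem_Icc]
        simp only at h2 h3
        omega
      refine nonneg_of_superharmonic_of_finite hfin (f := f) ?_ ?_ (i, y) ⟨hi, hy, hy0⟩
      · rintro ⟨a, b⟩ ⟨h1, h2, h3⟩
        have := latticeAvg_smearedPoisson (M := M) (k := k) (x₀ := x₀)
          (v := (x₀ + (a : ZMod N), k + b)) (by simp only at h3 ⊢; omega)
        simp only [latticeAvg, hf, hψ] at this ⊢
        rw [← this]
        push_cast
        rw [add_assoc x₀, ← add_assoc k b 1, ← add_sub_assoc x₀, ← add_sub_assoc k]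
        apply le_of_eq
        ring
      · rintro ⟨a, b⟩ ⟨hw, ⟨c, d⟩, ⟨h1, h2, h3⟩, hvw⟩
        simp only [Set.mem_ofPred_eq, not_and_or, not_lt] at hw
        simp only [abs_lt] at h1
        simp only at h2 h3
        have hb : |a| ≤ M ∧ -M ≤ b ∧ b ≤ 0 := by
          rw [abs_le]
          simp only [latticeNbr, Prod.mk.injEq] at hvw
          omega
        rcases hw with hw | hw | hw
        · have ha : (a : ℝ) ^ 2 = M ^ 2 := by
            have : |a| = M := le_antisymm hb.1 hw
            have h4 : a ^ 2 = (M : ℤ) ^ 2 := by rw [← this, sq_abs]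
            exact_mod_cast h4
          have hb1 : (b : ℝ) ≤ 0 := by exact_mod_cast hb.2.2
          have hb2 : (-M : ℝ) ≤ b := by exact_mod_cast hb.2.1
          have : ψ (a, b) ≤ 0 := by
            simp only [hψ]
            rw [ha]
            have : 1 - ((M : ℝ) ^ 2 - b ^ 2) / M ^ 2 + 2 * b / M = b * (b + 2 * M) / M ^ 2 := by
              field_simp
              ring
            rw [this]
            exact div_nonpos_of_nonpos_of_nonneg (by nlinarith) (by positivity)
          have h5 := hnn (x₀ + (a : ZMod N), k + b)
          simp only [hf]
          linarith
        · have hb' : b = -M := le_antisymm hw hb.2.1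
          have : ψ (a, b) ≤ 0 := by
            simp only [hψ, hb']
            push_cast
            have : 1 - ((a : ℝ) ^ 2 - (-(M : ℝ)) ^ 2) / M ^ 2 + 2 * -(M : ℝ) / M =
                -((a : ℝ) ^ 2 / M ^ 2) := by
              field_simp
              ring
            rw [this]
            exact neg_nonpos.mpr (by positivity)
          have h5 := hnn (x₀ + (a : ZMod N), k + b)
          simp only [hf]
          linarith
        · have hb' : b = 0 := le_antisymm hb.2.2 hw
          rw [hb']
          exact hlevel a hb.1
  simp only [hf, hψ] at main
  linarith

lemma le_smearedPoisson {r : ℕ} (hr : 0 < r) {i y : ℤ} (hi : |i| ≤ r) (hy : -(2 * r) ≤ y)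
    (hy0 : y ≤ 0) :
    1 / (2 * (32 * r + 1)) ≤ smearedPoisson (16 * r) k x₀ (x₀ + i, k + y) := by
  have h := sub_le_smearedPoisson (M := 16 * r) (k := k) (x₀ := x₀) (by omega)
    (i := i) (y := y) (by push_cast; omega) (by push_cast; omega) hy0
  push_cast at h
  have hr' : (0 : ℝ) < r := by exact_mod_cast hr
  have hi2 : (i : ℝ) ^ 2 ≤ r ^ 2 := by
    have : i ^ 2 ≤ (r : ℤ) ^ 2 := by rw [← sq_abs]; gcongr
    exact_mod_cast this
  have hy' : (-(2 * r) : ℝ) ≤ y := by exact_mod_cast hy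
  have h1 : ((i : ℝ) ^ 2 - y ^ 2) / (16 * r) ^ 2 ≤ 1 / 256 := by
    rw [div_le_div_iff₀ (by positivity) (by norm_num)]
    nlinarith [sq_nonneg (y : ℝ)]
  have h2 : -(1 / 4 : ℝ) ≤ 2 * y / (16 * r) := by
    rw [le_div_iff₀ (by positivity)]
    linarith
  rw [div_le_iff₀ (by positivity)]
  nlinarith

end SmearedPoisson

/-- A discretely subharmonic substitute for the potential kernel of the planar lattice. -/
noncomputable def logKernel (v : ℤ × ℤ) : ℝ :=
  Real.log (1 + (v.1 : ℝ) ^ 2 + (v.2 : ℝ) ^ 2) / Real.log 2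

lemma logKernel_le_latticeAvg (v : ℤ × ℤ) : logKernel v ≤ latticeAvg logKernel v := by
  obtain ⟨a, b⟩ := v
  have hl : 0 < Real.log 2 := Real.log_pos (by norm_num)
  simp only [latticeAvg, logKernel]
  push_cast
  generalize (a : ℝ) = x
  generalize (b : ℝ) = y
  have key : 4 * Real.log (1 + x ^ 2 + y ^ 2) ≤ Real.log (1 + (x + 1) ^ 2 + y ^ 2) +
      Real.log (1 + (x - 1) ^ 2 + y ^ 2) + Real.log (1 + x ^ 2 + (y + 1) ^ 2) +
      Real.log (1 + x ^ 2 + (y - 1) ^ 2) := by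
    rw [← Real.log_mul (by positivity) (by positivity), ← Real.log_mul (by positivity)
      (by positivity), ← Real.log_mul (by positivity) (by positivity),
      show (4 : ℝ) * Real.log (1 + x ^ 2 + y ^ 2) =
        Real.log ((1 + x ^ 2 + y ^ 2) ^ 4) by rw [Real.log_pow]; norm_num]
    refine Real.log_le_log (by positivity) ?_
    have h : (1 + (x + 1) ^ 2 + y ^ 2) * (1 + (x - 1) ^ 2 + y ^ 2) *
        (1 + x ^ 2 + (y + 1) ^ 2) * (1 + x ^ 2 + (y - 1) ^ 2) = (1 + x ^ 2 + y ^ 2) ^ 4 +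
        (2 * (1 + x ^ 2 + y ^ 2) ^ 2 + 8 * (1 + x ^ 2 + y ^ 2) + 5 + 16 * x ^ 2 * y ^ 2) := by
      ring
    rw [h]
    have : 0 ≤ 2 * (1 + x ^ 2 + y ^ 2) ^ 2 + 8 * (1 + x ^ 2 + y ^ 2) + 5 + 16 * x ^ 2 * y ^ 2 := by
      positivity
    linarith
  rw [← add_div, ← add_div, ← add_div, div_div, mul_comm (Real.log 2), ← div_div]
  refine div_le_div_of_nonneg_right ?_ hl.le
  linarith

lemma latticeAvg_logKernel_zero : latticeAvg logKernel 0 = logKernel 0 + 1 := by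
  have hl : Real.log 2 ≠ 0 := (Real.log_pos (by norm_num)).ne'
  simp [latticeAvg, logKernel]
  norm_num

lemma latticeAvg_logKernel_sub (v w : ℤ × ℤ) :
    latticeAvg (fun u => logKernel (u - w)) v = latticeAvg logKernel (v - w) := by
  simp only [latticeAvg, logKernel, Prod.fst_sub, Prod.snd_sub]
  push_cast
  ring_nf

lemma sum_log_div_le (n : ℕ) :
    ∑ i ∈ Finset.range n, Real.log (n / ((i : ℝ) + 1)) ≤ n := by
  rcases Nat.eq_zero_or_pos n with rfl | hn
  · simp
  have hn' : (0 : ℝ) < n := by exact_mod_cast hn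
  have h1 : ∑ i ∈ Finset.range n, Real.log (n / ((i : ℝ) + 1)) =
      Real.log ((n : ℝ) ^ n / (n.factorial : ℝ)) := by
    rw [← Real.log_prod (fun i _ => by positivity), Finset.prod_div_distrib,
      Finset.prod_const, Finset.card_range, ← Finset.prod_range_add_one_eq_factorial]
    push_cast
    rfl
  rw [h1, Real.log_le_iff_le_exp (by positivity)]
  exact Real.pow_div_factorial_le_exp _ hn'.le n

lemma sum_natAbs_le {n : ℕ} {f : ℕ → ℝ} (hf : ∀ i < n, 0 ≤ f i) :
    ∑ i ∈ Finset.Ioo (-n : ℤ) n, f i.natAbs ≤ 2 * ∑ i ∈ Finset.range n, f i := by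
  have hsub : Finset.Ioo (-n : ℤ) n ⊆ (Finset.range n).image (fun i : ℕ => (i : ℤ)) ∪
      (Finset.range n).image (fun i : ℕ => -(i : ℤ)) := by
    intro i hi
    rw [Finset.mem_Ioo] at hi
    simp only [Finset.mem_union, Finset.mem_image, Finset.mem_range]
    rcases le_total 0 i with h | h
    · exact Or.inl ⟨i.natAbs, by omega, by omega⟩
    · exact Or.inr ⟨i.natAbs, by omega, by omega⟩
  have hpos : ∀ i ∈ (Finset.range n).image (fun i : ℕ => (i : ℤ)) ∪
      (Finset.range n).image (fun i : ℕ => -(i : ℤ)), 0 ≤ f i.natAbs := by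
    intro i hi
    apply hf
    simp only [Finset.mem_union, Finset.mem_image, Finset.mem_range] at hi
    rcases hi with ⟨a, ha, rfl⟩ | ⟨a, ha, rfl⟩ <;> simpa using ha
  refine (Finset.sum_le_sum_of_subset_of_nonneg hsub fun i hi _ => hpos i hi).trans ?_
  have hui := Finset.sum_union_inter (s₁ := (Finset.range n).image (fun i : ℕ => (i : ℤ)))
    (s₂ := (Finset.range n).image (fun i : ℕ => -(i : ℤ))) (f := fun i => f i.natAbs)
  have hin : 0 ≤ ∑ i ∈ (Finset.range n).image (fun i : ℕ => (i : ℤ)) ∩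
      (Finset.range n).image (fun i : ℕ => -(i : ℤ)), f i.natAbs :=
    Finset.sum_nonneg fun i hi => hpos i (Finset.mem_union_left _ (Finset.mem_inter.mp hi).1)
  rw [Finset.sum_image (by simp), Finset.sum_image (by simp)] at hui
  simp only [Int.natAbs_natCast, Int.natAbs_neg] at hui
  linarith

lemma sum_log_div_norm_le {ν : ℕ} (hν : 0 < ν) (T : Finset (ℤ × ℤ)) (hT : T.card ≤ ν ^ 2) :
    ∑ w ∈ T, (Real.log (1 + 8 * (16 * ν : ℝ) ^ 2) - Real.log (1 + (w.1 : ℝ) ^ 2 + (w.2 : ℝ) ^ 2)) ≤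
      128 * ν ^ 2 * Real.log 2 := by
  have hν1 : (1 : ℝ) ≤ ν := by exact_mod_cast hν
  have hν' : (0 : ℝ) < ν := by linarith
  have hl : 1 / 2 < Real.log 2 := by have := Real.log_two_gt_d9; linarith
  set b : ℕ → ℝ := fun i => Real.log (ν / ((i : ℝ) + 1)) with hb
  have hb0 : ∀ i < ν, 0 ≤ b i := by
    intro i hi
    apply Real.log_nonneg
    rw [one_le_div (by positivity)]
    exact_mod_cast hi
  set Bx : Finset (ℤ × ℤ) := Finset.Ioo (-ν : ℤ) ν ×ˢ Finset.Ioo (-ν : ℤ) ν with hBx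
  have h12 : Real.log 4096 = 12 * Real.log 2 := by
    rw [show (4096 : ℝ) = 2 ^ 12 by norm_num, Real.log_pow]; norm_num
  have hbox0 : ∀ w ∈ Bx, 0 ≤ b w.1.natAbs + b w.2.natAbs := by
    intro w hw
    simp only [hBx, Finset.mem_product, Finset.mem_Ioo] at hw
    exact add_nonneg (hb0 _ (by omega)) (hb0 _ (by omega))
  have hterm : ∀ w ∈ T, Real.log (1 + 8 * (16 * ν : ℝ) ^ 2) -
      Real.log (1 + (w.1 : ℝ) ^ 2 + (w.2 : ℝ) ^ 2) ≤ 12 * Real.log 2 +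
        if w ∈ Bx then b w.1.natAbs + b w.2.natAbs else 0 := by
    rintro ⟨i, j⟩ _
    simp only
    split_ifs with hw
    · simp only [hb, Nat.cast_natAbs, Int.cast_abs]
      rw [← h12, ← Real.log_div (by positivity) (by positivity), ← Real.log_mul (by positivity)
        (by positivity), ← Real.log_mul (by positivity) (by positivity)]
      refine Real.log_le_log (by positivity) ?_
      rw [div_mul_div_comm, ← mul_div_assoc, div_le_div_iff₀ (by positivity) (by positivity)]
      rw [← sq_abs (i : ℝ), ← sq_abs (j : ℝ)]
      set x := |(i : ℝ)|
      set y := |(j : ℝ)|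
      have h1 : 1 + 8 * (16 * (ν : ℝ)) ^ 2 ≤ 2304 * ν ^ 2 := by nlinarith
      have h2 : (x + 1) * (y + 1) ≤ 1.5 * (1 + x ^ 2 + y ^ 2) := by
        nlinarith [sq_nonneg (x - y), sq_nonneg (x - 1 / 2), sq_nonneg (y - 1 / 2)]
      have hx : 0 ≤ x := abs_nonneg _
      have hy : 0 ≤ y := abs_nonneg _
      calc (1 + 8 * (16 * (ν : ℝ)) ^ 2) * ((x + 1) * (y + 1))
          ≤ (2304 * ν ^ 2) * (1.5 * (1 + x ^ 2 + y ^ 2)) := by gcongr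
        _ ≤ 4096 * (ν * ν) * (1 + x ^ 2 + y ^ 2) := by
          have : 0 ≤ (ν : ℝ) ^ 2 * (1 + x ^ 2 + y ^ 2) := by positivity
          nlinarith
    · rw [add_zero, ← h12, ← Real.log_div (by positivity) (by positivity)]
      refine Real.log_le_log (by positivity) ?_
      have hout : (ν : ℝ) ^ 2 ≤ 1 + (i : ℝ) ^ 2 + (j : ℝ) ^ 2 := by
        simp only [hBx, Finset.mem_product, Finset.mem_Ioo] at hw
        have hor : (ν : ℤ) ≤ |i| ∨ (ν : ℤ) ≤ |j| := by
          by_contra hcon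
          simp only [not_or, not_le, abs_lt] at hcon
          exact hw hcon
        have : (ν : ℤ) ^ 2 ≤ 1 + i ^ 2 + j ^ 2 := by
          rcases hor with h | h
          · have : (ν : ℤ) ^ 2 ≤ i ^ 2 := by rw [← sq_abs i]; gcongr
            nlinarith [sq_nonneg j]
          · have : (ν : ℤ) ^ 2 ≤ j ^ 2 := by rw [← sq_abs j]; gcongr
            nlinarith [sq_nonneg i]
        exact_mod_cast this
      rw [div_le_iff₀ (by positivity)]
      nlinarith
  refine (Finset.sum_le_sum hterm).trans ?_
  rw [Finset.sum_add_distrib, Finset.sum_const, nsmul_eq_mul, ← Finset.sum_filter]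
  have hcard : (T.card : ℝ) ≤ ν ^ 2 := by exact_mod_cast hT
  have hbsum : ∑ i ∈ Finset.Ioo (-ν : ℤ) ν, b i.natAbs ≤ 2 * ν :=
    (sum_natAbs_le hb0).trans (mul_le_mul_of_nonneg_left (sum_log_div_le ν) (by norm_num))
  have hIoo : ((Finset.Ioo (-ν : ℤ) ν).card : ℝ) ≤ 2 * ν := by
    rw [Int.card_Ioo]
    have : ((ν : ℤ) - -(ν : ℤ) - 1).toNat ≤ 2 * ν := by omega
    exact_mod_cast this
  have hboxsum : ∑ w ∈ Bx, (b w.1.natAbs + b w.2.natAbs) ≤ 8 * ν ^ 2 := by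
    rw [hBx, Finset.sum_product]
    simp only [Finset.sum_add_distrib, Finset.sum_const, nsmul_eq_mul, ← Finset.mul_sum]
    nlinarith
  have hfil : ∑ w ∈ T with w ∈ Bx, (b w.1.natAbs + b w.2.natAbs) ≤ 8 * ν ^ 2 := by
    refine (Finset.sum_le_sum_of_subset_of_nonneg ?_ fun w hw _ => hbox0 w hw).trans hboxsum
    intro w hw
    exact (Finset.mem_filter.mp hw).2
  have hν2 : (0 : ℝ) ≤ (ν : ℝ) ^ 2 := by positivity
  nlinarith [mul_le_mul_of_nonneg_right hcard (by linarith : 0 ≤ 12 * Real.log 2)]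

/-- A bounded subharmonic function on a square of side `32 ν`, supported by at most `ν ^ 2`
points, loses a factor two at the centre. -/
theorem le_half_of_subharmonic_of_card_le {ν : ℕ} (hν : 0 < ν) {G : ℤ × ℤ → ℝ} {B : ℝ}
    {T : Finset (ℤ × ℤ)} (hT : T.card ≤ ν ^ 2)
    (hTi : ∀ w ∈ T, |w.1| < 16 * ν ∧ |w.2| < 16 * ν)
    (hB : ∀ v : ℤ × ℤ, |v.1| ≤ 16 * ν → |v.2| ≤ 16 * ν → G v ≤ B)
    (hG : ∀ w ∈ T, G w ≤ latticeAvg G w)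
    (hG0 : ∀ v : ℤ × ℤ, |v.1| < 16 * ν → |v.2| < 16 * ν → v ∉ T → G v = 0) (hB0 : 0 ≤ B) :
    G 0 ≤ B / 2 := by
  have hν' : (0 : ℝ) < ν := by exact_mod_cast hν
  have hl : 0 < Real.log 2 := Real.log_pos (by norm_num)
  by_cases h0 : (0 : ℤ × ℤ) ∈ T
  swap
  · rw [hG0 0 (by simpa using hν) (by simpa using hν) h0]
    linarith
  set L : ℝ := 16 * ν with hL
  have hLpos : 0 < L := by positivity
  set Γ : ℝ := Real.log (1 + 8 * L ^ 2) / Real.log 2 with hΓ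
  set φ : ℤ × ℤ → ℝ := fun v => (B / L ^ 2) * (((v.1 : ℝ) ^ 2 + (v.2 : ℝ) ^ 2) +
    ∑ w ∈ T, (Γ - logKernel (v - w))) with hφ
  have hc : 0 ≤ B / L ^ 2 := by positivity
  have hφavg : ∀ v ∈ T, latticeAvg φ v ≤ φ v := by
    intro v hv
    rw [hφ, latticeAvg_const_mul, latticeAvg_add, latticeAvg_sum]
    refine mul_le_mul_of_nonneg_left ?_ hc
    have h1 : latticeAvg (fun u : ℤ × ℤ => (u.1 : ℝ) ^ 2 + (u.2 : ℝ) ^ 2) v =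
        (v.1 : ℝ) ^ 2 + (v.2 : ℝ) ^ 2 + 1 := by
      simp only [latticeAvg]
      push_cast
      ring
    have h2 : ∑ w ∈ T, latticeAvg (fun u => Γ - logKernel (u - w)) v + 1 ≤
        ∑ w ∈ T, (Γ - logKernel (v - w)) := by
      have : (1 : ℝ) = ∑ w ∈ T, if w = v then (1 : ℝ) else 0 := by simp [hv]
      rw [this, ← Finset.sum_add_distrib]
      refine Finset.sum_le_sum fun w _ => ?_
      rw [latticeAvg_sub, latticeAvg_const, latticeAvg_logKernel_sub]
      split_ifs with hwv
      · rw [hwv, sub_self, latticeAvg_logKernel_zero]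
        linarith
      · linarith [logKernel_le_latticeAvg (v - w)]
    rw [h1]
    linarith
  have hΓ0 : ∀ v : ℤ × ℤ, |v.1| ≤ 16 * ν → |v.2| ≤ 16 * ν → ∀ w ∈ T,
      0 ≤ Γ - logKernel (v - w) := by
    intro v hv1 hv2 w hw
    obtain ⟨hw1, hw2⟩ := hTi w hw
    rw [hΓ, logKernel, ← sub_div]
    refine div_nonneg (sub_nonneg.mpr (Real.log_le_log (by positivity) ?_)) hl.le
    have aux : ∀ a b : ℤ, |a| ≤ 16 * ν → |b| < 16 * ν → ((a - b : ℤ) : ℝ) ^ 2 ≤ 4 * L ^ 2 := by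
      intro a b ha hb
      have h1 : |a - b| ≤ 2 * (16 * ν) := (abs_sub a b).trans (by linarith)
      have h2 : (a - b) ^ 2 ≤ (2 * (16 * (ν : ℤ))) ^ 2 := by
        rw [← sq_abs (a - b)]; gcongr
      have h3 : ((a - b : ℤ) : ℝ) ^ 2 ≤ (2 * (16 * (ν : ℝ))) ^ 2 := by exact_mod_cast h2
      rw [hL]
      linarith
    have e1 := aux _ _ hv1 hw1
    have e2 := aux _ _ hv2 hw2
    simp only [Prod.fst_sub, Prod.snd_sub]
    linarith
  have hmain := nonneg_of_superharmonic_of_finite (D := (T : Set (ℤ × ℤ))) T.finite_toSet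
    (f := fun v => φ v - G v) ?_ ?_ 0 h0
  · have hφ0 : φ 0 ≤ B / 2 := by
      have hs := sum_log_div_norm_le hν T hT
      have : φ 0 = (B / L ^ 2) * ((∑ w ∈ T, (Real.log (1 + 8 * L ^ 2) -
          Real.log (1 + (w.1 : ℝ) ^ 2 + (w.2 : ℝ) ^ 2))) / Real.log 2) := by
        simp only [hφ, Finset.sum_div, hΓ, logKernel, sub_div]
        simp
      rw [this]
      have h3 : (∑ w ∈ T, (Real.log (1 + 8 * L ^ 2) -
          Real.log (1 + (w.1 : ℝ) ^ 2 + (w.2 : ℝ) ^ 2))) / Real.log 2 ≤ L ^ 2 / 2 := by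
        rw [div_le_iff₀ hl]
        refine hs.trans (le_of_eq ?_)
        rw [hL]; ring
      calc _ ≤ (B / L ^ 2) * (L ^ 2 / 2) := mul_le_mul_of_nonneg_left h3 hc
        _ = B / 2 := by field_simp
    linarith
  · intro v hv
    rw [latticeAvg_sub]
    linarith [hφavg v hv, hG v hv]
  · rintro w ⟨hw, v, hv, hvw⟩
    have hv' := hTi v hv
    have hwle : |w.1| ≤ 16 * ν ∧ |w.2| ≤ 16 * ν := by
      obtain ⟨a, b⟩ := v
      obtain ⟨c, d⟩ := w
      simp only [abs_lt, abs_le, latticeNbr, Prod.mk.injEq] at hv' hvw ⊢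
      omega
    have hsum := Finset.sum_nonneg (hΓ0 w hwle.1 hwle.2)
    by_cases hin : |w.1| < 16 * ν ∧ |w.2| < 16 * ν
    · rw [hG0 w hin.1 hin.2 hw, sub_zero]
      exact mul_nonneg hc (by positivity)
    · have hGB := hB w hwle.1 hwle.2
      have hLw : L ^ 2 ≤ (w.1 : ℝ) ^ 2 + (w.2 : ℝ) ^ 2 := by
        have : (16 * (ν : ℤ)) ^ 2 ≤ w.1 ^ 2 + w.2 ^ 2 := by
          rw [not_and_or, not_lt, not_lt] at hin
          rcases hin with h | h
          · have : (16 * (ν : ℤ)) ^ 2 ≤ w.1 ^ 2 := by rw [← sq_abs w.1]; gcongr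
            nlinarith [sq_nonneg w.2]
          · have : (16 * (ν : ℤ)) ^ 2 ≤ w.2 ^ 2 := by rw [← sq_abs w.2]; gcongr
            nlinarith [sq_nonneg w.1]
        rw [hL]
        exact_mod_cast this
      have : B ≤ φ w := by
        calc B = (B / L ^ 2) * L ^ 2 := by field_simp
          _ ≤ φ w := mul_le_mul_of_nonneg_left (by linarith) hc
      show 0 ≤ φ w - G w
      linarith

/-- The square of radius `r` around `z` in the cylinder. -/
def cylBox {N : ℕ} (z : ZMod N × ℤ) (r : ℕ) : Set (ZMod N × ℤ) :=
  {v | ∃ i j : ℤ, |i| ≤ r ∧ |j| ≤ r ∧ v = (z.1 + (i : ZMod N), z.2 + j)}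

section CylBox

variable {N : ℕ} {z v w : ZMod N × ℤ}

lemma mem_cylBox_self (z : ZMod N × ℤ) (r : ℕ) : z ∈ cylBox z r :=
  ⟨0, 0, by simp, by simp, by simp⟩

lemma cylBox_mono {a b : ℕ} (h : a ≤ b) : cylBox z a ⊆ cylBox z b := by
  rintro v ⟨i, j, hi, hj, hv⟩
  exact ⟨i, j, hi.trans (by exact_mod_cast h), hj.trans (by exact_mod_cast h), hv⟩

lemma mem_cylBox_trans {a b : ℕ} (hv : v ∈ cylBox z a) (hw : w ∈ cylBox v b) :
    w ∈ cylBox z (a + b) := by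
  obtain ⟨i, j, hi, hj, rfl⟩ := hv
  obtain ⟨i', j', hi', hj', rfl⟩ := hw
  refine ⟨i + i', j + j', (abs_add_le _ _).trans ?_, (abs_add_le _ _).trans ?_, ?_⟩
  · push_cast; linarith
  · push_cast; linarith
  · ext <;> simp <;> ring

lemma mem_cylBox_symm {a : ℕ} (hv : v ∈ cylBox z a) : z ∈ cylBox v a := by
  obtain ⟨i, j, hi, hj, rfl⟩ := hv
  exact ⟨-i, -j, by rwa [abs_neg], by rwa [abs_neg], by ext <;> simp⟩

lemma mem_cylBox_of_latticeNbr (h : latticeNbr v w) : w ∈ cylBox v 1 := by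
  rcases h with rfl | rfl | rfl | rfl
  · exact ⟨1, 0, by simp, by simp, by simp⟩
  · exact ⟨-1, 0, by simp, by simp, by simp [sub_eq_add_neg]⟩
  · exact ⟨0, 1, by simp, by simp, by simp⟩
  · exact ⟨0, -1, by simp, by simp, by simp [sub_eq_add_neg]⟩

lemma snd_mem_of_mem_cylBox {a : ℕ} (hv : v ∈ cylBox z a) :
    z.2 - a ≤ v.2 ∧ v.2 ≤ z.2 + a := by
  obtain ⟨i, j, hi, hj, rfl⟩ := hv
  rw [abs_le] at hj
  simp only
  omega

end CylBox

open Classical in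
/-- The number of points of `S` at distance at most `r` from `z`. -/
noncomputable def boxCount {N : ℕ} (S : Finset (ZMod N × ℤ)) (z : ZMod N × ℤ) (r : ℕ) : ℕ :=
  (S.filter (· ∈ cylBox z r)).card

lemma le_half_of_subharmonic_cylinder {N ν : ℕ} (hν : 0 < ν) (hN : 32 * ν + 1 ≤ N)
    {S : Finset (ZMod N × ℤ)} {g : ZMod N × ℤ → ℝ} {y : ZMod N × ℤ} {B : ℝ} (hB0 : 0 ≤ B)
    (hcard : boxCount S y (16 * ν) ≤ ν ^ 2) (hB : ∀ v ∈ cylBox y (16 * ν), g v ≤ B)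
    (hG : ∀ v ∈ S, v ∈ cylBox y (16 * ν - 1) → g v ≤ latticeAvg g v)
    (hG0 : ∀ v ∈ cylBox y (16 * ν), v ∉ S → g v = 0) : g y ≤ B / 2 := by
  classical
  set p : ℤ × ℤ → ZMod N × ℤ := fun u => (y.1 + (u.1 : ZMod N), y.2 + u.2) with hp
  set T : Finset (ℤ × ℤ) := (Finset.Ioo (-(16 * ν) : ℤ) (16 * ν) ×ˢ
    Finset.Ioo (-(16 * ν) : ℤ) (16 * ν)).filter (fun u => p u ∈ S) with hT
  have hTmem : ∀ u, u ∈ T ↔ (|u.1| < 16 * ν ∧ |u.2| < 16 * ν) ∧ p u ∈ S := by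
    intro u
    rw [hT, Finset.mem_filter, Finset.mem_product, Finset.mem_Ioo, Finset.mem_Ioo, abs_lt, abs_lt]
  have hTcard : T.card ≤ ν ^ 2 := by
    refine le_trans (Finset.card_le_card_of_injOn p ?_ ?_) hcard
    · intro u hu
      obtain ⟨⟨h1, h2⟩, h3⟩ := (hTmem u).mp hu
      rw [Finset.mem_coe, Finset.mem_filter]
      exact ⟨h3, u.1, u.2, by push_cast; exact h1.le, by push_cast; exact h2.le, rfl⟩
    · intro u hu u' hu' h
      obtain ⟨⟨h1, h2⟩, -⟩ := (hTmem u).mp hu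
      obtain ⟨⟨h1', h2'⟩, -⟩ := (hTmem u').mp hu'
      simp only [hp, Prod.mk.injEq, add_right_inj] at h
      obtain ⟨ha, hb⟩ := h
      rw [ZMod.intCast_eq_intCast_iff_dvd_sub] at ha
      have h0 : u'.1 - u.1 = 0 := by
        refine Int.eq_zero_of_abs_lt_dvd ha ?_
        rw [abs_lt] at h1 h1' ⊢
        omega
      exact Prod.ext (by omega) hb
  have h := le_half_of_subharmonic_of_card_le hν (G := fun u => g (p u)) (B := B) hTcard
    (fun w hw => ((hTmem w).mp hw).1) ?_ ?_ ?_ hB0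
  · simpa [hp] using h
  · intro v h1 h2
    exact hB _ ⟨v.1, v.2, by push_cast; exact h1, by push_cast; exact h2, rfl⟩
  · intro w hw
    obtain ⟨⟨h1, h2⟩, h3⟩ := (hTmem w).mp hw
    have h4 := hG _ h3 ⟨w.1, w.2, by omega, by omega, rfl⟩
    simp only [latticeAvg, hp] at h4 ⊢
    push_cast
    rw [← add_assoc y.1, ← add_sub_assoc y.1, ← add_assoc y.2, ← add_sub_assoc y.2]
    exact h4
  · intro v h1 h2 h3
    refine hG0 _ ⟨v.1, v.2, by push_cast; exact h1.le, by push_cast; exact h2.le, rfl⟩ ?_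
    intro h4
    exact h3 ((hTmem v).mpr ⟨⟨h1, h2⟩, h4⟩)

/-- A bounded subharmonic function supported by few points decays exponentially fast away from
the complement of the region where it lives. -/
theorem le_half_pow_of_subharmonic {N ν : ℕ} (hν : 0 < ν) (hN : 32 * ν + 1 ≤ N)
    {S : Finset (ZMod N × ℤ)} {g : ZMod N × ℤ → ℝ} {D : Set (ZMod N × ℤ)}
    (hcard : ∀ y, cylBox y (16 * ν) ⊆ D → boxCount S y (16 * ν) ≤ ν ^ 2)
    (hB : ∀ v ∈ D, g v ≤ 1)
    (hG : ∀ v ∈ S, (∀ w, latticeNbr v w → w ∈ D) → g v ≤ latticeAvg g v)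
    (hG0 : ∀ v ∈ D, v ∉ S → g v = 0) (s : ℕ) :
    ∀ y, cylBox y (s * (16 * ν)) ⊆ D → g y ≤ (1 / 2) ^ s := by
  induction s with
  | zero =>
    intro y hy
    simpa using hB y (hy (mem_cylBox_self y _))
  | succ s ih =>
    intro y hy
    have hsub : cylBox y (16 * ν) ⊆ D := (cylBox_mono (by nlinarith)).trans hy
    have h := le_half_of_subharmonic_cylinder hν hN (g := g) (y := y) (B := (1 / 2) ^ s)
      (by positivity) (hcard y hsub) ?_ ?_ ?_
    · rw [pow_succ]
      linarith
    · intro v hv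
      refine ih v (subset_trans ?_ hy)
      intro w hw
      have := mem_cylBox_trans hv hw
      rwa [show 16 * ν + s * (16 * ν) = (s + 1) * (16 * ν) by ring] at this
    · intro v hv hvy
      refine hG v hv fun w hw => hsub ?_
      have := mem_cylBox_trans hvy (mem_cylBox_of_latticeNbr hw)
      rwa [show 16 * ν - 1 + 1 = 16 * ν by omega] at this
    · intro v hv
      exact hG0 v (hsub hv)

/-- The half cylinder below level zero together with the finite set `S`. -/
def cluster {N : ℕ} (S : Finset (ZMod N × ℤ)) : Set (ZMod N × ℤ) := {v | v.2 ≤ 0} ∪ S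

section Cluster

variable {N : ℕ} {S : Finset (ZMod N × ℤ)}

lemma exists_cluster_le (S : Finset (ZMod N × ℤ)) : ∃ K : ℤ, 0 ≤ K ∧ ∀ v ∈ cluster S, v.2 ≤ K := by
  classical
  refine ⟨∑ v ∈ S, |v.2|, Finset.sum_nonneg fun _ _ => abs_nonneg _, ?_⟩
  rintro v (hv | hv)
  · exact le_trans hv (Finset.sum_nonneg fun _ _ => abs_nonneg _)
  · exact (le_abs_self _).trans
      (Finset.single_le_sum (f := fun v : ZMod N × ℤ => |v.2|) (fun _ _ => abs_nonneg _) hv)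

lemma pos_of_notMem_cluster {v : ZMod N × ℤ} (h : v ∉ cluster S) : 1 ≤ v.2 := by
  by_contra hcon
  exact h (Or.inl (show v.2 ≤ 0 by omega))

lemma mem_of_mem_cluster {v : ZMod N × ℤ} (h : v ∈ cluster S) (hv : 1 ≤ v.2) : v ∈ S := by
  rcases h with h | h
  · have : v.2 ≤ 0 := h
    omega
  · exact h

lemma zero_mem_cluster (x : ZMod N) : (x, (0 : ℤ)) ∈ cluster S :=
  Or.inl (show (0 : ℤ) ≤ 0 from le_rfl)

lemma finite_latticeBdry_cluster [NeZero N] (S : Finset (ZMod N × ℤ)) :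
    (latticeBdry (cluster S)).Finite := by
  obtain ⟨K, -, hK⟩ := exists_cluster_le S
  refine (finite_snd_mem_Icc 1 (K + 1)).subset ?_
  rintro w ⟨hw, v, hv, hvw⟩
  have h1 := pos_of_notMem_cluster hw
  have h2 := hK v hv
  have h3 := hvw.snd_le.1
  exact ⟨h1, by linarith⟩

/-- The finite outer boundary of a cluster. -/
noncomputable def clusterBdry [NeZero N] (S : Finset (ZMod N × ℤ)) : Finset (ZMod N × ℤ) :=
  (finite_latticeBdry_cluster S).toFinset

lemma coe_clusterBdry [NeZero N] (S : Finset (ZMod N × ℤ)) :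
    (clusterBdry S : Set (ZMod N × ℤ)) = latticeBdry (cluster S) :=
  (finite_latticeBdry_cluster S).coe_toFinset

lemma mem_clusterBdry [NeZero N] {y : ZMod N × ℤ} :
    y ∈ clusterBdry S ↔ y ∈ latticeBdry (cluster S) :=
  (finite_latticeBdry_cluster S).mem_toFinset

/-- The expectation of `f` at the exit point from the cluster of `S` of a walk started uniformly
on level zero. -/
noncomputable def startMean [NeZero N] (S : Finset (ZMod N × ℤ)) (f : ZMod N × ℤ → ℝ) : ℝ :=
  (N : ℝ)⁻¹ * ∑ x : ZMod N, exitMean (cluster S) (clusterBdry S) f (x, 0)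

end Cluster

/-- A walk is much more likely to stick to the cluster in an annulus containing few points of the
cluster than to cross this annulus. -/
theorem startMean_annulus_sub_nonneg {N ν : ℕ} [NeZero N] (hν : 0 < ν) (hN : 32 * ν + 1 ≤ N)
    {S : Finset (ZMod N × ℤ)} {z : ZMod N × ℤ} {r s : ℕ} {K : ℝ} (hK0 : 0 ≤ K)
    (hK : K + 1 ≤ 2 ^ s) (hz : ((r + 2 * (s * (16 * ν)) + 1 : ℕ) : ℤ) < z.2)
    (hcard : boxCount S z (r + 2 * (s * (16 * ν)) + 1) ≤ ν ^ 2) {φ : ZMod N × ℤ → ℝ}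
    (hin : ∀ v ∈ cylBox z r, φ v = -K) (hout : ∀ v ∉ cylBox z r, 0 ≤ φ v)
    (hann : ∀ v ∈ cylBox z (r + 2 * (s * (16 * ν)) + 1), v ∉ cylBox z r → φ v = 1)
    (hφ1 : ∀ v, φ v ≤ 1) :
    0 ≤ startMean S φ := by
  classical
  have hN3 : 3 ≤ N := by omega
  set l := s * (16 * ν) with hl
  set e := exitMean (cluster S) (clusterBdry S) φ with he
  obtain ⟨H, hH0, hH⟩ := exists_cluster_le S
  have hF := coe_clusterBdry S
  have hφK : ∀ v, -K ≤ φ v := by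
    intro v
    by_cases hv : v ∈ cylBox z r
    · rw [hin v hv]
    · exact le_trans (by linarith) (hout v hv)
  have hφabs : ∀ v, |φ v| ≤ 1 + K := by
    intro v
    have h1 := hφK v
    have h2 := hφ1 v
    rw [abs_le]
    constructor <;> linarith
  have heK : ∀ v ∈ cluster S, -K ≤ e v := by
    intro v hv
    refine (le_exitMean_of_subharmonic hN3 hF hH (f := fun _ => -K) (C := K) ?_ ?_ v hv).trans
      (exitMean_mono hN3 (fun y _ => hφK y) v)
    · intro _; rw [abs_neg, abs_of_nonneg hK0]
    · intro v _; rw [latticeAvg_const]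
  have hbd : ∀ v ∈ cluster S, ∀ w, latticeNbr v w → w ∉ cluster S → e w = φ w :=
    fun v hv w hvw hw => exitMean_of_mem_bdry hN3 hF φ ⟨hw, v, hv, hvw⟩
  have hpos : ∀ v ∈ cylBox z (r + 2 * l + 1), 1 ≤ v.2 := by
    intro v hv
    have := (snd_mem_of_mem_cylBox hv).1
    omega
  have hmid : ∀ y ∈ cluster S, y ∈ cylBox z (r + l + 1) → y ∉ cylBox z (r + l) → 0 ≤ e y := by
    intro y hyA hy1 hy2
    set g : ZMod N × ℤ → ℝ := fun v => if v ∈ S then (1 - e v) / (1 + K) else 0 with hg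
    have hg1 := le_half_pow_of_subharmonic hν hN (S := S) (g := g)
      (D := cylBox z (r + 2 * l + 1) \ cylBox z r) ?_ ?_ ?_ ?_ s y ?_
    · have hyS : y ∈ S := mem_of_mem_cluster hyA (hpos y (cylBox_mono (by omega) hy1))
      simp only [hg, if_pos hyS] at hg1
      rw [div_le_iff₀ (by linarith)] at hg1
      have : (1 / 2 : ℝ) ^ s * (1 + K) ≤ 1 := by
        rw [one_div, inv_pow, inv_mul_le_iff₀ (by positivity)]
        linarith
      linarith
    · intro v hv
      refine le_trans ?_ hcard
      refine Finset.card_le_card fun w hw => ?_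
      rw [Finset.mem_filter] at hw ⊢
      exact ⟨hw.1, (hv hw.2).1⟩
    · intro v hv
      simp only [hg]
      split_ifs with h
      · rw [div_le_one (by linarith)]
        linarith [heK v (Or.inr h)]
      · exact zero_le_one
    · intro v hv hvD
      have hvA : v ∈ cluster S := Or.inr hv
      have hval : ∀ w, latticeNbr v w → g w = (1 - e w) / (1 + K) := by
        intro w hw
        simp only [hg]
        split_ifs with hwS
        · rfl
        · have hwD := hvD w hw
          have hwA : w ∉ cluster S := fun h => hwS (mem_of_mem_cluster h (hpos w hwD.1))
          rw [hbd v hvA w hw hwA, hann w hwD.1 hwD.2]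
          simp
      obtain ⟨h1, h2, h3, h4⟩ := latticeNbr_cases hval
      have hev := latticeAvg_exitMean hN3 (F := clusterBdry S) φ hvA
      rw [← he] at hev
      simp only [latticeAvg] at hev
      simp only [latticeAvg, h1, h2, h3, h4]
      simp only [hg, if_pos hv]
      rw [← hev]
      apply le_of_eq
      ring
    · intro v _ hvS
      simp only [hg, if_neg hvS]
    · intro w hw
      refine ⟨?_, ?_⟩
      · have := mem_cylBox_trans hy1 hw
        rwa [show r + l + 1 + l = r + 2 * l + 1 by ring] at this
      · intro hwr
        exact hy2 (mem_cylBox_trans hwr (mem_cylBox_symm hw))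
  have hmain := nonneg_of_superharmonic_of_bddBelow (D := cluster S \ cylBox z (r + l + 1))
    (K := H) (fun v hv => hH v hv.1) (f := e) (B := (clusterBdry S).card * (1 + K))
    (fun v => neg_le_of_abs_le (abs_exitMean_le hN3 hφabs v))
    (fun v hv => (latticeAvg_exitMean hN3 φ hv.1).le) ?_
  · refine mul_nonneg (by positivity) (Finset.sum_nonneg fun x _ => ?_)
    refine hmain _ ⟨zero_mem_cluster x, fun h => ?_⟩
    have := hpos _ (cylBox_mono (by omega) h)
    simp at this
  · rintro w ⟨hw, v, hv, hvw⟩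
    have hwin : w ∉ cylBox z (r + l) := by
      intro h
      have := mem_cylBox_trans h (mem_cylBox_symm (mem_cylBox_of_latticeNbr hvw))
      exact hv.2 this
    by_cases hwA : w ∈ cluster S
    · refine hmid w hwA ?_ hwin
      by_contra h
      exact hw ⟨hwA, h⟩
    · rw [hbd v hv.1 w hvw hwA]
      exact hout w fun h => hwin (cylBox_mono (by omega) h)

section StartMean

variable {N : ℕ} [NeZero N] {S : Finset (ZMod N × ℤ)}

/-- The probability that a walk started uniformly on level zero exits the cluster of `S`
at `y`. -/
noncomputable def exitWeight (S : Finset (ZMod N × ℤ)) (y : ZMod N × ℤ) : ℝ :=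
  (N : ℝ)⁻¹ * ∑ x : ZMod N, hitMeas cylNbrZ (bdryS cylNbrZ (cluster S)) (x, 0) y

lemma startMean_eq_sum (S : Finset (ZMod N × ℤ)) (f : ZMod N × ℤ → ℝ) :
    startMean S f = ∑ y ∈ clusterBdry S, exitWeight S y * f y := by
  simp only [startMean, exitMean, exitWeight]
  rw [Finset.sum_comm, Finset.mul_sum]
  refine Finset.sum_congr rfl fun y _ => ?_
  rw [← Finset.sum_mul, mul_assoc]

lemma exitWeight_nonneg (hN : 3 ≤ N) (S : Finset (ZMod N × ℤ)) (y : ZMod N × ℤ) :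
    0 ≤ exitWeight S y :=
  mul_nonneg (by positivity) (Finset.sum_nonneg fun _ _ => (hitMeas_mem_Icc hN _ _ _).1)

lemma startMean_mono (hN : 3 ≤ N) {f g : ZMod N × ℤ → ℝ} (h : ∀ y ∈ clusterBdry S, f y ≤ g y) :
    startMean S f ≤ startMean S g := by
  rw [startMean_eq_sum, startMean_eq_sum]
  exact Finset.sum_le_sum fun y hy =>
    mul_le_mul_of_nonneg_left (h y hy) (exitWeight_nonneg hN S y)

lemma startMean_add (f g : ZMod N × ℤ → ℝ) :
    startMean S (fun y => f y + g y) = startMean S f + startMean S g := by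
  simp only [startMean_eq_sum, mul_add, Finset.sum_add_distrib]

lemma startMean_const_mul (c : ℝ) (f : ZMod N × ℤ → ℝ) :
    startMean S (fun y => c * f y) = c * startMean S f := by
  simp only [startMean_eq_sum, mul_left_comm _ c, Finset.mul_sum]

lemma startMean_sum {ι : Type*} (s : Finset ι) (f : ι → ZMod N × ℤ → ℝ) :
    startMean S (fun y => ∑ i ∈ s, f i y) = ∑ i ∈ s, startMean S (f i) := by
  simp only [startMean_eq_sum, Finset.mul_sum]
  exact Finset.sum_comm

lemma inv_mul_sum_zmod_const (c : ℝ) : (N : ℝ)⁻¹ * ∑ _x : ZMod N, c = c := by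
  have : (N : ℝ) ≠ 0 := by exact_mod_cast NeZero.ne N
  rw [Finset.sum_const, Finset.card_univ, ZMod.card, nsmul_eq_mul, ← mul_assoc,
    inv_mul_cancel₀ this, one_mul]

lemma startMean_const (hN : 3 ≤ N) (c : ℝ) : startMean S (fun _ => c) = c := by
  obtain ⟨K, -, hK⟩ := exists_cluster_le S
  have h1 : startMean S (fun _ => (1 : ℝ)) = 1 := by
    rw [startMean]
    simp only [exitMean_one hN (coe_clusterBdry S) hK (zero_mem_cluster _)]
    exact inv_mul_sum_zmod_const 1
  have := startMean_const_mul (S := S) c (fun _ => (1 : ℝ))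
  simpa [h1] using this

lemma le_startMean_of_subharmonic (hN : 3 ≤ N) {f : ZMod N × ℤ → ℝ} {C : ℝ}
    (hC : ∀ v, |f v| ≤ C) (hf : ∀ v ∈ cluster S, f v ≤ latticeAvg f v) :
    (N : ℝ)⁻¹ * ∑ x : ZMod N, f (x, 0) ≤ startMean S f := by
  obtain ⟨K, -, hK⟩ := exists_cluster_le S
  rw [startMean]
  refine mul_le_mul_of_nonneg_left (Finset.sum_le_sum fun x _ => ?_) (by positivity)
  exact le_exitMean_of_subharmonic hN (coe_clusterBdry S) hK hC hf _ (zero_mem_cluster x)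

end StartMean

lemma cluster_insert {N : ℕ} (S : Finset (ZMod N × ℤ)) (y : ZMod N × ℤ) :
    cluster (insert y S) = insert y (cluster S) := by
  simp only [cluster, Finset.coe_insert]
  exact Set.union_insert

lemma eq_of_cluster_eq {N : ℕ} {S T : Finset (ZMod N × ℤ)} (hS : ∀ v ∈ S, 1 ≤ v.2)
    (hT : ∀ v ∈ T, 1 ≤ v.2) (h : cluster S = cluster T) : S = T := by
  ext v
  constructor
  · intro hv
    exact mem_of_mem_cluster (h ▸ Or.inr hv) (hS v hv)
  · intro hv
    exact mem_of_mem_cluster (h ▸ Or.inr hv : v ∈ cluster S) (hT v hv)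

section Growth

variable {N : ℕ} {Ω : Type} {I : ℕ → Ω → Set (ZMod N × ℤ)} {Y : ℕ → Ω → ZMod N × ℤ}

lemma exists_eq_cluster (hI0 : ∀ ω, I 0 ω = cylRect N 0)
    (hstep : ∀ n ω, I (n + 1) ω = insert (Y (n + 1) ω) (I n ω))
    (hY : ∀ n ω, Y (n + 1) ω ∈ bdryS cylNbrZ (I n ω)) (n : ℕ) (ω : Ω) :
    ∃ S : Finset (ZMod N × ℤ), (∀ v ∈ S, 1 ≤ v.2) ∧ I n ω = cluster S := by
  induction n with
  | zero =>
    refine ⟨∅, by simp, ?_⟩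
    rw [hI0]
    ext v
    simp [cluster, cylRect]
  | succ n ih =>
    obtain ⟨S, hS, hIS⟩ := ih
    have hy := hY n ω
    rw [hIS] at hy
    refine ⟨insert (Y (n + 1) ω) S, ?_, ?_⟩
    · intro v hv
      rcases Finset.mem_insert.mp hv with rfl | hv
      · exact pos_of_notMem_cluster hy.1
      · exact hS v hv
    · rw [hstep, hIS, cluster_insert]

/-- A supermartingale bound for the internal DLA process. -/
theorem measure_one_le_potential_le [NeZero N] [MeasurableSpace Ω] (P : Measure Ω)
    [IsProbabilityMeasure P] (hI0 : ∀ ω, I 0 ω = cylRect N 0)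
    (hstep : ∀ n ω, I (n + 1) ω = insert (Y (n + 1) ω) (I n ω))
    (hY : ∀ n ω, Y (n + 1) ω ∈ bdryS cylNbrZ (I n ω))
    (hlaw : ∀ (n : ℕ) (A : Set (ZMod N × ℤ)), ∀ y ∈ bdryS cylNbrZ A,
        P {ω | I n ω = A ∧ Y (n + 1) ω = y}
          = ENNReal.ofReal
              ((N : ℝ)⁻¹ * ∑ j ∈ Finset.range N,
                hitMeas cylNbrZ (bdryS cylNbrZ A) ((j : ZMod N), 0) y) *
            P {ω | I n ω = A})
    (hN : 3 ≤ N) {V : ℕ → Finset (ZMod N × ℤ) → ℝ} (hV0 : ∀ j S, 0 ≤ V j S) {n : ℕ}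
    (hV : ∀ j < n, ∀ S : Finset (ZMod N × ℤ), (∀ v ∈ S, 1 ≤ v.2) →
      startMean S (fun y => V (j + 1) (insert y S)) ≤ V j S) :
    P {ω | ∃ S : Finset (ZMod N × ℤ), (∀ v ∈ S, 1 ≤ v.2) ∧ I n ω = cluster S ∧ 1 ≤ V n S} ≤
      ENNReal.ofReal (V 0 ∅) := by
  classical
  set valid : Finset (ZMod N × ℤ) → Prop := fun S => ∀ v ∈ S, 1 ≤ v.2 with hvalid
  set p : ℕ → Finset (ZMod N × ℤ) → ENNReal :=
    fun j S => if valid S then P {ω | I j ω = cluster S} else 0 with hp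
  set E : ℕ → ENNReal := fun j => ∑' S, p j S * ENNReal.ofReal (V j S) with hE
  have hE0 : E 0 ≤ ENNReal.ofReal (V 0 ∅) := by
    have : E 0 = p 0 ∅ * ENNReal.ofReal (V 0 ∅) := by
      refine tsum_eq_single ∅ fun S hS => ?_
      simp only [hp]
      split_ifs with hval
      · have : {ω | I 0 ω = cluster S} = ∅ := by
          rw [Set.eq_empty_iff_forall_notMem]
          intro ω hω
          have hω' : I 0 ω = cluster S := hω
          apply hS
          refine eq_of_cluster_eq hval (by simp) ?_
          rw [← hω', hI0]
          ext v
          simp [cluster, cylRect]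
        rw [this, measure_empty, zero_mul]
      · rw [zero_mul]
    rw [this]
    refine mul_le_of_le_one_left (zero_le) ?_
    simp only [hp]
    split_ifs
    · exact prob_le_one
    · exact zero_le_one
  have hEstep : ∀ j < n, E (j + 1) ≤ E j := by
    intro j hj
    set q : Finset (ZMod N × ℤ) → ZMod N × ℤ → ENNReal :=
      fun S y => if valid S then P {ω | I j ω = cluster S ∧ Y (j + 1) ω = y} else 0 with hq
    have hpT : ∀ T, p (j + 1) T ≤
        ∑' S, ∑ y ∈ clusterBdry S, if insert y S = T then q S y else 0 := by
      intro T
      simp only [hp]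
      split_ifs with hT
      swap
      · exact zero_le
      have hsub : {ω | I (j + 1) ω = cluster T} ⊆ ⋃ S : Finset (ZMod N × ℤ),
          ⋃ y ∈ clusterBdry S,
            {ω | valid S ∧ insert y S = T ∧ I j ω = cluster S ∧ Y (j + 1) ω = y} := by
        intro ω hω
        have hω' : I (j + 1) ω = cluster T := hω
        obtain ⟨S, hS, hIS⟩ := exists_eq_cluster hI0 hstep hY j ω
        have hy := hY j ω
        rw [hIS, bdryS_cylNbrZ] at hy
        simp only [Set.mem_iUnion]
        refine ⟨S, Y (j + 1) ω, mem_clusterBdry.mpr hy, hS, ?_, hIS, rfl⟩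
        refine eq_of_cluster_eq ?_ hT ?_
        · intro v hv
          rcases Finset.mem_insert.mp hv with rfl | hv
          · exact pos_of_notMem_cluster hy.1
          · exact hS v hv
        · rw [cluster_insert, ← hIS, ← hstep, hω']
      refine (measure_mono hsub).trans ((measure_iUnion_le _).trans ?_)
      refine ENNReal.tsum_le_tsum fun S => (measure_biUnion_finset_le _ _).trans ?_
      refine Finset.sum_le_sum fun y _ => ?_
      split_ifs with hins
      · simp only [hq]
        split_ifs with hS
        · exact measure_mono fun ω hω => ⟨hω.2.2.1, hω.2.2.2⟩
        · refine le_of_eq (measure_mono_null (t := ∅) (fun ω hω => hS hω.1) measure_empty)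
      · exact le_of_eq (measure_mono_null (t := ∅) (fun ω hω => hins hω.2.1) measure_empty)
    calc E (j + 1) ≤ ∑' T, (∑' S, ∑ y ∈ clusterBdry S, if insert y S = T then q S y else 0) *
          ENNReal.ofReal (V (j + 1) T) := ENNReal.tsum_le_tsum fun T => by gcongr; exact hpT T
      _ = ∑' S, ∑' T, (∑ y ∈ clusterBdry S, if insert y S = T then q S y else 0) *
          ENNReal.ofReal (V (j + 1) T) := by
        rw [ENNReal.tsum_comm]
        exact tsum_congr fun T => ENNReal.tsum_mul_right.symm
      _ = ∑' S, ∑ y ∈ clusterBdry S, q S y * ENNReal.ofReal (V (j + 1) (insert y S)) := by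
        refine tsum_congr fun S => ?_
        simp only [Finset.sum_mul]
        rw [Summable.tsum_finsetSum fun _ _ => ENNReal.summable]
        refine Finset.sum_congr rfl fun y _ => ?_
        rw [tsum_eq_single (insert y S)]
        · simp
        · intro T hT
          rw [if_neg hT.symm, zero_mul]
      _ ≤ E j := by
        refine ENNReal.tsum_le_tsum fun S => ?_
        simp only [hp, hq]
        split_ifs with hS
        swap
        · simp
        have hqy : ∀ y ∈ clusterBdry S, P {ω | I j ω = cluster S ∧ Y (j + 1) ω = y} *
            ENNReal.ofReal (V (j + 1) (insert y S)) = P {ω | I j ω = cluster S} *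
              ENNReal.ofReal (exitWeight S y * V (j + 1) (insert y S)) := by
          intro y hy
          rw [hlaw j (cluster S) y (by rw [bdryS_cylNbrZ]; exact mem_clusterBdry.mp hy),
            ENNReal.ofReal_mul (exitWeight_nonneg hN S y), exitWeight,
            ← sum_zmod_eq_sum_range (fun i => hitMeas cylNbrZ (bdryS cylNbrZ (cluster S))
              ((i : ZMod N), 0) y)]
          simp only [ZMod.natCast_zmod_val]
          ring
        rw [Finset.sum_congr rfl hqy, ← Finset.mul_sum, ← ENNReal.ofReal_sum_of_nonneg
          (fun y _ => mul_nonneg (exitWeight_nonneg hN S y) (hV0 _ _)), ← startMean_eq_sum S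
          (fun y => V (j + 1) (insert y S))]
        gcongr
        exact hV j hj S hS
  have hEn : ∀ j ≤ n, E j ≤ E 0 := by
    intro j
    induction j with
    | zero => intro _; exact le_rfl
    | succ j ih => intro hj; exact (hEstep j (by omega)).trans (ih (by omega))
  refine le_trans ?_ ((hEn n le_rfl).trans hE0)
  have hsub : {ω | ∃ S : Finset (ZMod N × ℤ), (∀ v ∈ S, 1 ≤ v.2) ∧ I n ω = cluster S ∧
      1 ≤ V n S} ⊆ ⋃ S : Finset (ZMod N × ℤ), {ω | valid S ∧ I n ω = cluster S ∧ 1 ≤ V n S} := by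
    rintro ω ⟨S, h1, h2, h3⟩
    exact Set.mem_iUnion.mpr ⟨S, h1, h2, h3⟩
  refine (measure_mono hsub).trans ((measure_iUnion_le _).trans ?_)
  refine ENNReal.tsum_le_tsum fun S => ?_
  by_cases h : valid S ∧ 1 ≤ V n S
  · simp only [hp, if_pos h.1]
    calc P {ω | valid S ∧ I n ω = cluster S ∧ 1 ≤ V n S} ≤ P {ω | I n ω = cluster S} * 1 := by
          rw [mul_one]; exact measure_mono fun ω hω => hω.2.1
      _ ≤ _ := by
          gcongr
          rw [ENNReal.one_le_ofReal]
          exact h.2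
  · refine le_trans (le_of_eq ?_) (zero_le)
    exact measure_mono_null (t := ∅) (fun ω hω => h ⟨hω.1, hω.2.2⟩) measure_empty

end Growth

section Exponential

variable {N : ℕ} [NeZero N] {S : Finset (ZMod N × ℤ)}

lemma exp_le_one_add_add_sq {u : ℝ} (hu : |u| ≤ 1) : Real.exp u ≤ 1 + u + u ^ 2 := by
  have h := Real.abs_exp_sub_one_sub_id_le hu
  have := (abs_le.mp h).2
  linarith

/-- Exponential moment bound for the increment of a bounded martingale or submartingale. -/
lemma startMean_exp_le (hN : 3 ≤ N) {H : ZMod N × ℤ → ℝ} {θ s : ℝ} (hθ : |θ| ≤ 1)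
    (hs1 : s ≤ 1) (hH0 : ∀ y, 0 ≤ H y) (hHs : ∀ y ∈ clusterBdry S, |H y - (N : ℝ)⁻¹| ≤ s)
    (hs0 : 0 ≤ s) (hmean : (N : ℝ)⁻¹ ≤ startMean S H)
    (hθmean : θ * (startMean S H - (N : ℝ)⁻¹) ≤ 0) :
    startMean S (fun y => Real.exp (θ * (H y - (N : ℝ)⁻¹))) ≤ Real.exp (2 * θ ^ 2 * (s / N)) := by
  set e := (N : ℝ)⁻¹ with he
  have he0 : 0 ≤ e := by positivity
  have hpt : ∀ y ∈ clusterBdry S, Real.exp (θ * (H y - e)) ≤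
      (1 - θ * e + θ ^ 2 * s * e) + (θ + θ ^ 2 * s) * H y := by
    intro y hy
    have hx := hHs y hy
    have habs : |θ * (H y - e)| ≤ 1 := by
      rw [abs_mul]
      exact mul_le_one₀ hθ (abs_nonneg _) (hx.trans hs1)
    have hsq : (H y - e) ^ 2 ≤ s * (H y + e) := by
      have h1 : |H y - e| ≤ H y + e := by
        rw [abs_le]
        constructor <;> linarith [hH0 y]
      calc (H y - e) ^ 2 = |H y - e| * |H y - e| := by rw [abs_mul_abs_self, sq]
        _ ≤ s * (H y + e) := mul_le_mul hx h1 (abs_nonneg _) hs0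
    have := exp_le_one_add_add_sq habs
    nlinarith [mul_le_mul_of_nonneg_left hsq (sq_nonneg θ)]
  refine (startMean_mono hN hpt).trans ?_
  rw [startMean_add, startMean_const hN, startMean_const_mul]
  set M := startMean S H with hM
  have hkey : (θ + θ ^ 2 * s) * (M - e) ≤ 0 := by
    rcases le_or_gt θ 0 with h | h
    · have h1 : 0 ≤ 1 + θ * s := by
        have : |θ * s| ≤ 1 := by
          rw [abs_mul, abs_of_nonneg hs0]
          exact mul_le_one₀ hθ hs0 hs1
        linarith [(abs_le.mp this).1]
      have : (θ + θ ^ 2 * s) * (M - e) = (1 + θ * s) * (θ * (M - e)) := by ring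
      rw [this]
      exact mul_nonpos_of_nonneg_of_nonpos h1 hθmean
    · have h0 : M - e ≤ 0 := by
        by_contra hc
        push Not at hc
        exact absurd hθmean (not_le.mpr (mul_pos h hc))
      have h1 : M - e = 0 := le_antisymm h0 (by linarith)
      rw [h1, mul_zero]
  have := Real.add_one_le_exp (2 * θ ^ 2 * (s / N))
  rw [div_eq_mul_inv] at this ⊢
  linarith

/-- The exponential potential built from the sum of `H` over the cluster. -/
noncomputable def expPotential (θ c : ℝ) (H : ZMod N × ℤ → ℝ) (R : ℕ → ℝ) (j : ℕ)
    (S : Finset (ZMod N × ℤ)) : ℝ :=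
  Real.exp (θ * (∑ y ∈ S, H y - (j : ℝ) / N) + R j - c)

lemma notMem_of_mem_clusterBdry {y : ZMod N × ℤ} (hy : y ∈ clusterBdry S) : y ∉ S := fun h =>
  (mem_clusterBdry.mp hy).1 (Or.inr h)

lemma startMean_expPotential_le (hN : 3 ≤ N) {H : ZMod N × ℤ → ℝ} {θ s c : ℝ} {R : ℕ → ℝ}
    {j : ℕ} (hθ : |θ| ≤ 1) (hs0 : 0 ≤ s) (hs1 : s ≤ 1) (hH0 : ∀ y, 0 ≤ H y)
    (hHs : ∀ y ∈ clusterBdry S, |H y - (N : ℝ)⁻¹| ≤ s) (hmean : (N : ℝ)⁻¹ ≤ startMean S H)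
    (hθmean : θ * (startMean S H - (N : ℝ)⁻¹) ≤ 0) (hR : R j = R (j + 1) + 2 * θ ^ 2 * (s / N)) :
    startMean S (fun y => expPotential θ c H R (j + 1) (insert y S)) ≤
      expPotential θ c H R j S := by
  have hrw : ∀ y ∈ clusterBdry S, expPotential θ c H R (j + 1) (insert y S) ≤
      (expPotential θ c H R j S * Real.exp (-(2 * θ ^ 2 * (s / N)))) *
        Real.exp (θ * (H y - (N : ℝ)⁻¹)) := by
    intro y hy
    simp only [expPotential]
    rw [Finset.sum_insert (notMem_of_mem_clusterBdry hy), ← Real.exp_add, ← Real.exp_add, hR]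
    apply le_of_eq
    congr 1
    push_cast
    ring
  refine (startMean_mono hN hrw).trans ?_
  rw [startMean_const_mul, mul_assoc]
  refine mul_le_of_le_one_right (Real.exp_pos _).le ?_
  calc _ ≤ Real.exp (-(2 * θ ^ 2 * (s / N))) * Real.exp (2 * θ ^ 2 * (s / N)) :=
        mul_le_mul_of_nonneg_left (startMean_exp_le hN hθ hs1 hH0 hHs hs0 hmean hθmean)
          (Real.exp_pos _).le
    _ = 1 := by rw [← Real.exp_add, neg_add_cancel, Real.exp_zero]

end Exponential

/-- The accumulated variance budget between time `j` and time `n`, for a drift that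
depends on the height `i / N` of the cluster at time `i`. -/
noncomputable def varBudget (N : ℕ) (θ : ℝ) (σ : ℕ → ℝ) (n j : ℕ) : ℝ :=
  2 * θ ^ 2 * (∑ i ∈ Finset.range n, σ (i / N) / N - ∑ i ∈ Finset.range j, σ (i / N) / N)

lemma varBudget_self (N : ℕ) (θ : ℝ) (σ : ℕ → ℝ) (n : ℕ) : varBudget N θ σ n n = 0 := by
  simp [varBudget]

lemma varBudget_succ (N : ℕ) (θ : ℝ) (σ : ℕ → ℝ) (n j : ℕ) :
    varBudget N θ σ n j = varBudget N θ σ n (j + 1) + 2 * θ ^ 2 * (σ (j / N) / N) := by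
  rw [varBudget, varBudget, Finset.sum_range_succ _ j]
  ring

lemma varBudget_nonneg {N : ℕ} {θ : ℝ} {σ : ℕ → ℝ} (hσ : ∀ q, 0 ≤ σ q) {n j : ℕ} (h : j ≤ n) :
    0 ≤ varBudget N θ σ n j := by
  refine mul_nonneg (by positivity) (sub_nonneg.mpr ?_)
  refine Finset.sum_le_sum_of_subset_of_nonneg (Finset.range_mono h) fun i _ _ => ?_
  exact div_nonneg (hσ _) (by positivity)

lemma sum_range_mul_div {N : ℕ} (hN : 0 < N) (σ : ℕ → ℝ) (D : ℕ) :
    ∑ i ∈ Finset.range (N * D), σ (i / N) / N = ∑ q ∈ Finset.range D, σ q := by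
  induction D with
  | zero => simp
  | succ D ih =>
    rw [Nat.mul_succ, Finset.sum_range_add, ih, Finset.sum_range_succ]
    congr 1
    have : ∀ i ∈ Finset.range N, σ ((N * D + i) / N) / N = σ D / N := by
      intro i hi
      rw [Nat.mul_add_div hN, Nat.div_eq_of_lt (Finset.mem_range.mp hi), add_zero]
    rw [Finset.sum_congr rfl this, Finset.sum_const, Finset.card_range, nsmul_eq_mul]
    have : (N : ℝ) ≠ 0 := by positivity
    field_simp

lemma sum_oscBound_sub_le {N : ℕ} (hN : 1 ≤ N) (e : ℤ) (t : ℕ) (D : ℕ) (hD : (D : ℤ) ≤ e + t) :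
    ∑ q ∈ Finset.range D, oscBound N (e - q) ≤ 1 + Real.log N + t := by
  have hlog : 0 ≤ Real.log N := Real.log_natCast_nonneg N
  have hone : ∀ s : Finset ℕ, ∀ f : ℕ → ℤ, ∑ q ∈ s, oscBound N (f q) ≤ s.card := by
    intro s f
    calc _ ≤ ∑ _q ∈ s, (1 : ℝ) := Finset.sum_le_sum fun q _ => oscBound_le_one N _
      _ = s.card := by simp
  rcases lt_or_ge e 0 with he | he
  · have h1 := hone (Finset.range D) (fun q => e - q)
    rw [Finset.card_range] at h1
    have : (D : ℝ) ≤ t := by exact_mod_cast (by omega : D ≤ t)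
    linarith
  · obtain ⟨e', rfl⟩ := Int.eq_ofNat_of_zero_le he
    have hsub : ∑ q ∈ Finset.range D, oscBound N ((e' : ℤ) - q) ≤
        ∑ q ∈ Finset.range (e' + t), oscBound N ((e' : ℤ) - q) :=
      Finset.sum_le_sum_of_subset_of_nonneg (Finset.range_mono (by omega))
        fun _ _ _ => oscBound_nonneg N _
    refine hsub.trans ?_
    rw [Finset.sum_range_add]
    have h2 := hone (Finset.range t) (fun q => (e' : ℤ) - ((e' + q : ℕ) : ℤ))
    rw [Finset.card_range] at h2
    have h3 : ∑ q ∈ Finset.range e', oscBound N ((e' : ℤ) - q) =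
        ∑ d ∈ Finset.range e', oscBound N ((d : ℤ) + 1) := by
      rw [← Finset.sum_range_reflect]
      refine Finset.sum_congr rfl fun d hd => ?_
      have := Finset.mem_range.mp hd
      congr 1
      omega
    have h4 := sum_oscBound_le hN e'
    rw [h3]
    linarith

lemma varBudget_oscBound_le {N : ℕ} (hN : 1 ≤ N) (θ : ℝ) (hθ : 2 * θ ^ 2 ≤ 1) (e : ℤ) (t D : ℕ)
    (hD : (D : ℤ) ≤ e + t) :
    varBudget N θ (fun q => oscBound N (e - q)) (N * D) 0 ≤ 1 + Real.log N + 2 * θ ^ 2 * t := by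
  have hlog : 0 ≤ Real.log N := Real.log_natCast_nonneg N
  rw [varBudget, sum_range_mul_div (by omega) (fun q => oscBound N (e - q))]
  have := sum_oscBound_sub_le hN e t D hD
  simp only [Finset.range_zero, Finset.sum_empty, sub_zero]
  calc _ ≤ 2 * θ ^ 2 * (1 + Real.log N + t) := mul_le_mul_of_nonneg_left this (by positivity)
    _ ≤ _ := by nlinarith [mul_nonneg (sub_nonneg.mpr hθ) (add_nonneg zero_le_one hlog)]

section LevelSums

variable {N : ℕ} [NeZero N]

lemma sum_univ_product_eq {f : ZMod N × ℤ → ℝ} {s : Finset ℤ}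
    (hf : ∀ y ∈ s, ∑ x : ZMod N, f (x, y) = 1) :
    ∑ v ∈ (Finset.univ : Finset (ZMod N)) ×ˢ s, f v = s.card := by
  rw [Finset.sum_product_right, Finset.sum_congr rfl hf]
  simp

lemma sum_levelPoisson_le {k : ℕ} {x₀ : ZMod N} (hk : 1 ≤ k) {T : Finset (ZMod N × ℤ)}
    (hT : ∀ v ∈ T, 1 ≤ v.2) (hz : (x₀, (k : ℤ)) ∉ T) :
    ∑ v ∈ T, levelPoisson k x₀ v ≤ k - 1 := by
  set B := (Finset.univ : Finset (ZMod N)) ×ˢ Finset.Icc (1 : ℤ) (k - 1) with hB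
  have h1 : ∑ v ∈ T, levelPoisson k x₀ v = ∑ v ∈ T.filter (· ∈ B), levelPoisson k x₀ v := by
    symm
    refine Finset.sum_filter_of_ne fun v hv hne => ?_
    rw [hB, Finset.mem_product]
    refine ⟨Finset.mem_univ _, ?_⟩
    rw [Finset.mem_Icc]
    refine ⟨hT v hv, ?_⟩
    by_contra hc
    push Not at hc
    apply hne
    rcases lt_or_ge (k : ℤ) v.2 with h | h
    · exact levelPoisson_of_lt h
    · have hvk : v = (v.1, (k : ℤ)) := Prod.ext rfl (by omega : v.2 = k)
      rw [hvk, levelPoisson_level, if_neg]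
      intro hx
      rw [hvk, hx] at hv
      exact hz hv
  rw [h1]
  have h2 : ∑ v ∈ T.filter (· ∈ B), levelPoisson k x₀ v ≤ ∑ v ∈ B, levelPoisson k x₀ v :=
    Finset.sum_le_sum_of_subset_of_nonneg (fun v hv => (Finset.mem_filter.mp hv).2)
      fun v _ _ => levelPoisson_nonneg v
  refine h2.trans (le_of_eq ?_)
  rw [hB, sum_univ_product_eq fun y hy => sum_levelPoisson (by
    have := (Finset.mem_Icc.mp hy).2; omega)]
  rw [Int.card_Icc]
  have : ((k : ℤ) - 1 + 1 - 1).toNat = k - 1 := by omega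
  rw [this, Nat.cast_sub hk]
  simp

lemma le_sum_smearedPoisson {p a b : ℕ} {x₀ : ZMod N} (hb : 0 < b) {T : Finset (ZMod N × ℤ)}
    (hT : ∀ v : ZMod N × ℤ, 1 ≤ v.2 → v.2 ≤ (p : ℤ) - a → v ∈ T) :
    (p : ℝ) - a + boxCount T (x₀, (p + b + 1 : ℤ)) b * (1 / (2 * (32 * b + 1))) ≤
      ∑ v ∈ T, smearedPoisson (16 * b) (p + b + 1 + b) x₀ v := by
  classical
  set H := smearedPoisson (16 * b) (p + b + 1 + b) x₀ with hH
  set A := (Finset.univ : Finset (ZMod N)) ×ˢ Finset.Icc (1 : ℤ) (p - a) with hA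
  set F := T.filter (· ∈ cylBox ((x₀, (p + b + 1 : ℤ)) : ZMod N × ℤ) b) with hF
  have hdisj : Disjoint A F := by
    rw [Finset.disjoint_left]
    intro v hv hvF
    have h1 := (Finset.mem_Icc.mp (Finset.mem_product.mp hv).2).2
    have h2 := (snd_mem_of_mem_cylBox (Finset.mem_filter.mp hvF).2).1
    simp only at h2
    omega
  have hsub : A ∪ F ⊆ T := by
    intro v hv
    rcases Finset.mem_union.mp hv with hv | hv
    · have h1 := Finset.mem_Icc.mp (Finset.mem_product.mp hv).2
      exact hT v h1.1 h1.2
    · exact (Finset.mem_filter.mp hv).1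
  have h1 : ∑ v ∈ A ∪ F, H v ≤ ∑ v ∈ T, H v :=
    Finset.sum_le_sum_of_subset_of_nonneg hsub fun v _ _ => smearedPoisson_nonneg v
  rw [Finset.sum_union hdisj] at h1
  have h2 : ∑ v ∈ A, H v = ((Finset.Icc (1 : ℤ) (p - a)).card : ℝ) := by
    refine sum_univ_product_eq fun y hy => sum_smearedPoisson ?_
    have := (Finset.mem_Icc.mp hy).2
    omega
  have h3 : (p : ℝ) - a ≤ ((Finset.Icc (1 : ℤ) (p - a)).card : ℝ) := by
    rw [Int.card_Icc]
    have : (p : ℤ) - a ≤ (((p : ℤ) - a + 1 - 1).toNat : ℤ) := by omega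
    exact_mod_cast this
  have h4 : (F.card : ℝ) * (1 / (2 * (32 * b + 1))) ≤ ∑ v ∈ F, H v := by
    rw [← nsmul_eq_mul]
    refine Finset.card_nsmul_le_sum _ _ _ fun v hv => ?_
    obtain ⟨i, l, hi, hl, hv⟩ := (Finset.mem_filter.mp hv).2
    have hl' := abs_le.mp hl
    have hle := le_smearedPoisson (N := N) (k := (p + b + 1 + b : ℤ)) (x₀ := x₀) hb hi
      (y := l - b) (by omega) (by omega)
    have hveq : v = (x₀ + (i : ZMod N), (p + b + 1 + b : ℤ) + (l - b)) := by
      rw [hv]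
      refine Prod.ext rfl ?_
      simp only
      ring
    rw [hveq]
    exact hle
  have h5 : boxCount T ((x₀, (p + b + 1 : ℤ)) : ZMod N × ℤ) b = F.card := by
    rw [boxCount, hF]
  rw [h5]
  linarith

end LevelSums

/-- The cluster of `S` agrees, up to `a` levels below and `b` levels above, with the
rectangle of height `j / N`. -/
def NearRect {N : ℕ} (a b j : ℕ) (S : Finset (ZMod N × ℤ)) : Prop :=
  (∀ v : ZMod N × ℤ, v.2 ≤ ((j / N : ℕ) : ℤ) - a → v ∈ cluster S) ∧
    ∀ v ∈ S, v.2 ≤ ((j / N : ℕ) : ℤ) + b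

section NearRect

variable {N : ℕ} [NeZero N] {a b j : ℕ} {S : Finset (ZMod N × ℤ)}

omit [NeZero N] in
lemma nearRect_zero (a b : ℕ) : NearRect a b 0 (∅ : Finset (ZMod N × ℤ)) := by
  refine ⟨fun v hv => Or.inl ?_, by simp⟩
  rw [Nat.zero_div] at hv
  change v.2 ≤ 0
  push_cast at hv
  omega

omit [NeZero N] in
lemma NearRect.cluster_le (h : NearRect a b j S) {v : ZMod N × ℤ} (hv : v ∈ cluster S) :
    v.2 ≤ ((j / N : ℕ) : ℤ) + b := by
  rcases hv with hv | hv
  · have hv' : v.2 ≤ 0 := hv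
    have := Int.natCast_nonneg (j / N)
    omega
  · exact h.2 v hv

lemma NearRect.bdry_le (h : NearRect a b j S) {y : ZMod N × ℤ} (hy : y ∈ clusterBdry S) :
    y.2 ≤ ((j / N : ℕ) : ℤ) + b + 1 := by
  obtain ⟨-, x, hx, hxy⟩ := mem_clusterBdry.mp hy
  have h1 := h.cluster_le hx
  have h2 := hxy.snd_le.1
  omega

lemma insert_pos (hS : ∀ v ∈ S, 1 ≤ v.2) {y : ZMod N × ℤ} (hy : y ∈ clusterBdry S) :
    ∀ v ∈ insert y S, 1 ≤ v.2 := by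
  intro v hv
  rcases Finset.mem_insert.mp hv with rfl | hv
  · exact pos_of_notMem_cluster (mem_clusterBdry.mp hy).1
  · exact hS v hv

/-- The first time the cluster leaves the strip around the rectangle, either a level is
completed too late or a site is occupied too early. -/
lemma late_or_early_of_not_nearRect (hS : ∀ v ∈ S, 1 ≤ v.2) (h : NearRect a b j S)
    {y : ZMod N × ℤ} (hy : y ∈ clusterBdry S) (hbad : ¬ NearRect a b (j + 1) (insert y S)) :
    (∃ x₀ : ZMod N, ∃ k : ℕ, 1 ≤ k ∧ j + 1 = N * (k + a) ∧ (x₀, (k : ℤ)) ∉ insert y S) ∨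
      ∃ x₀ : ZMod N, ∃ p : ℕ, (j + 1) / N = p ∧ j / N = p ∧ y = (x₀, (p + b + 1 : ℤ)) := by
  have hsucc : (j + 1) / N = j / N + if N ∣ j + 1 then 1 else 0 := Nat.succ_div
  have hpos := insert_pos hS hy
  rw [NearRect, not_and_or] at hbad
  rcases hbad with hbad | hbad
  · left
    push Not at hbad
    obtain ⟨v, hv, hvT⟩ := hbad
    have hv1 : 1 ≤ v.2 := pos_of_notMem_cluster hvT
    have hvS : v ∉ cluster S := fun hc => hvT (by rw [cluster_insert]; exact Or.inr hc)
    have hlt : ((j / N : ℕ) : ℤ) - a < v.2 := by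
      by_contra hc
      exact hvS (h.1 v (not_lt.mp hc))
    split_ifs at hsucc with hdvd
    · refine ⟨v.1, v.2.toNat, by omega, ?_, ?_⟩
      · have : v.2.toNat + a = (j + 1) / N := by omega
        rw [this, Nat.mul_div_cancel' hdvd]
      · have : (v.1, ((v.2.toNat : ℕ) : ℤ)) = v := Prod.ext rfl (by simp only; omega)
        rw [this]
        exact fun hc => hvT (Or.inr hc)
    · omega
  · right
    push Not at hbad
    obtain ⟨v, hv, hvb⟩ := hbad
    rcases Finset.mem_insert.mp hv with rfl | hvS
    · have h1 := h.bdry_le hy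
      split_ifs at hsucc with hdvd
      · omega
      · refine ⟨v.1, j / N, by omega, rfl, Prod.ext rfl ?_⟩
        simp only
        omega
    · have := h.2 v hvS
      split_ifs at hsucc with hdvd <;> omega

end NearRect

section Late

variable {N : ℕ} [NeZero N] {a b j k : ℕ} {x₀ : ZMod N} {δ : ℝ} {S : Finset (ZMod N × ℤ)}

open Classical in
/-- Potential detecting that `(x₀, k)` is still vacant at time `N * (k + a)`. -/
noncomputable def latePotential (N : ℕ) [NeZero N] (δ : ℝ) (a b : ℕ) (x₀ : ZMod N) (k j : ℕ)
    (S : Finset (ZMod N × ℤ)) : ℝ :=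
  if j ≤ N * (k + a) ∧ (x₀, (k : ℤ)) ∉ cluster S then
    expPotential (-δ) (δ * (a + 1)) (levelPoisson k x₀)
      (varBudget N (-δ) (fun q => oscBound N ((k - b - 1 : ℤ) - q)) (N * (k + a))) j S
  else 0

lemma latePotential_nonneg (S : Finset (ZMod N × ℤ)) : 0 ≤ latePotential N δ a b x₀ k j S := by
  rw [latePotential]
  split_ifs
  · exact (Real.exp_pos _).le
  · exact le_rfl

lemma startMean_latePotential_le (hN : 3 ≤ N) (hδ0 : 0 ≤ δ) (hδ1 : δ ≤ 1)
    (h : NearRect a b j S) :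
    startMean S (fun y => latePotential N δ a b x₀ k (j + 1) (insert y S)) ≤
      latePotential N δ a b x₀ k j S := by
  classical
  by_cases hc : j + 1 ≤ N * (k + a) ∧ (x₀, (k : ℤ)) ∉ cluster S
  · have hle : ∀ y ∈ clusterBdry S, latePotential N δ a b x₀ k (j + 1) (insert y S) ≤
        expPotential (-δ) (δ * (a + 1)) (levelPoisson k x₀)
          (varBudget N (-δ) (fun q => oscBound N ((k - b - 1 : ℤ) - q)) (N * (k + a)))
          (j + 1) (insert y S) := by
      intro y _
      rw [latePotential]
      split_ifs
      · exact le_rfl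
      · exact (Real.exp_pos _).le
    refine (startMean_mono hN hle).trans ?_
    rw [latePotential, if_pos ⟨by omega, hc.2⟩]
    have hmean : (N : ℝ)⁻¹ ≤ startMean S (levelPoisson k x₀) := by
      have := le_startMean_of_subharmonic (S := S) hN (f := levelPoisson k x₀) (C := 1)
        abs_levelPoisson_le_one (fun v hv => levelPoisson_le_latticeAvg (by
          rintro rfl; exact hc.2 hv))
      rwa [sum_levelPoisson (by positivity), mul_one] at this
    refine startMean_expPotential_le hN (by rw [abs_neg, abs_of_nonneg hδ0]; exact hδ1)
      (oscBound_nonneg N ((k - b - 1 : ℤ) - (j / N : ℕ))) (oscBound_le_one N _)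
      levelPoisson_nonneg (fun y hy => ?_) hmean ?_ (varBudget_succ _ _ _ _ _)
    · have := abs_levelPoisson_sub_le (k := (k : ℤ)) (x₀ := x₀) y
      rw [one_div] at this
      refine this.trans (oscBound_anti N ?_)
      have := h.bdry_le hy
      omega
    · exact mul_nonpos_of_nonpos_of_nonneg (by linarith) (by linarith)
  · have : ∀ y, latePotential N δ a b x₀ k (j + 1) (insert y S) = 0 := by
      intro y
      rw [latePotential, if_neg]
      rintro ⟨h1, h2⟩
      exact hc ⟨h1, fun h3 => h2 (by rw [cluster_insert]; exact Or.inr h3)⟩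
    simp only [this]
    rw [startMean_const hN]
    exact latePotential_nonneg S

lemma one_le_latePotential (hδ0 : 0 ≤ δ) (hk : 1 ≤ k) (hS : ∀ v ∈ S, 1 ≤ v.2)
    (hz : (x₀, (k : ℤ)) ∉ S) : 1 ≤ latePotential N δ a b x₀ k (N * (k + a)) S := by
  have hz' : (x₀, (k : ℤ)) ∉ cluster S := fun h => hz (mem_of_mem_cluster h (by
    simp only; omega))
  rw [latePotential, if_pos ⟨le_rfl, hz'⟩, expPotential, varBudget_self]
  refine Real.one_le_exp ?_
  have h1 := sum_levelPoisson_le hk hS hz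
  have hN : (N : ℝ) ≠ 0 := by exact_mod_cast NeZero.ne N
  have h2 : ((N * (k + a) : ℕ) : ℝ) / N = k + a := by
    push_cast
    field_simp
  rw [h2]
  nlinarith

lemma latePotential_zero_le (hδ : 2 * δ ^ 2 ≤ 1) :
    latePotential N δ a b x₀ k 0 ∅ ≤
      Real.exp (1 + Real.log N + 2 * δ ^ 2 * (a + b + 1) - δ * (a + 1)) := by
  rw [latePotential]
  split_ifs
  swap
  · exact (Real.exp_pos _).le
  rw [expPotential]
  refine Real.exp_le_exp.mpr ?_
  have := varBudget_oscBound_le (N := N) NeZero.one_le (-δ) (by rwa [neg_sq]) (k - b - 1)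
    (a + b + 1) (k + a) (by push_cast; omega)
  rw [neg_sq] at this
  push_cast at this
  simp only [Finset.sum_empty, CharP.cast_eq_zero, zero_div, sub_zero, mul_zero]
  linarith

end Late

section Early

variable {N : ℕ} [NeZero N] {a b j p : ℕ} {x₀ : ZMod N} {δ : ℝ} {S : Finset (ZMod N × ℤ)}

/-- Potential detecting too many occupied sites near `(x₀, p + b + 1)` before time
`N * (p + 1)`. -/
noncomputable def earlyPotential (N : ℕ) [NeZero N] (δ : ℝ) (a b : ℕ) (x₀ : ZMod N) (p j : ℕ)
    (S : Finset (ZMod N × ℤ)) : ℝ :=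
  if j ≤ N * (p + 1) then
    expPotential δ (δ * (a + 1)) (smearedPoisson (16 * b) (p + b + 1 + b) x₀)
      (varBudget N δ (fun q => oscBound N ((p + b : ℤ) - q)) (N * (p + 1))) j S
  else 0

lemma earlyPotential_nonneg (S : Finset (ZMod N × ℤ)) : 0 ≤ earlyPotential N δ a b x₀ p j S := by
  rw [earlyPotential]
  split_ifs
  · exact (Real.exp_pos _).le
  · exact le_rfl

lemma startMean_earlyPotential_le (hN : 3 ≤ N) (hδ0 : 0 ≤ δ) (hδ1 : δ ≤ 1)
    (h : NearRect a b j S) :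
    startMean S (fun y => earlyPotential N δ a b x₀ p (j + 1) (insert y S)) ≤
      earlyPotential N δ a b x₀ p j S := by
  by_cases hc : j + 1 ≤ N * (p + 1)
  · simp only [earlyPotential, if_pos hc]
    rw [if_pos (by omega)]
    have hq : j / N ≤ p := by
      have : j / N < p + 1 := Nat.div_lt_of_lt_mul (by omega)
      omega
    set H := smearedPoisson (16 * b) (p + b + 1 + b) x₀ with hH
    have hharm : ∀ v ∈ cluster S, latticeAvg H v = H v := by
      intro v hv
      have := h.cluster_le hv
      exact latticeAvg_smearedPoisson (by omega)
    have hHabs : ∀ v, |H v| ≤ 1 := fun v => by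
      rw [abs_of_nonneg (smearedPoisson_nonneg v)]
      exact smearedPoisson_le_one v
    have hsum : ∑ x : ZMod N, H (x, 0) = 1 := sum_smearedPoisson (by positivity)
    have hge : (N : ℝ)⁻¹ ≤ startMean S H := by
      have := le_startMean_of_subharmonic (S := S) hN hHabs (fun v hv => (hharm v hv).ge)
      rwa [hsum, mul_one] at this
    have hle : startMean S H ≤ (N : ℝ)⁻¹ := by
      have := le_startMean_of_subharmonic (S := S) hN (f := fun v => (-1) * H v) (C := 1)
        (fun v => by rw [neg_one_mul, abs_neg]; exact hHabs v)
        (fun v hv => by rw [latticeAvg_const_mul, hharm v hv])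
      rw [startMean_const_mul, ← Finset.mul_sum, hsum] at this
      linarith
    refine startMean_expPotential_le hN (by rw [abs_of_nonneg hδ0]; exact hδ1)
      (oscBound_nonneg N ((p + b : ℤ) - (j / N : ℕ))) (oscBound_le_one N _)
      smearedPoisson_nonneg (fun y hy => ?_) hge ?_ (varBudget_succ _ _ _ _ _)
    · have := abs_smearedPoisson_sub_le (M := 16 * b) (k := (p + b + 1 + b : ℤ)) (x₀ := x₀) y
      rw [one_div] at this
      refine this.trans (oscBound_anti N ?_)
      have := h.bdry_le hy
      omega
    · rw [le_antisymm hle hge, sub_self, mul_zero]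
  · simp only [earlyPotential, if_neg hc]
    rw [startMean_const hN]
    exact earlyPotential_nonneg S

lemma one_le_earlyPotential (hδ0 : 0 ≤ δ) (hb : 0 < b) (hj : j ≤ N * (p + 1))
    (hS : ∀ v : ZMod N × ℤ, 1 ≤ v.2 → v.2 ≤ (p : ℤ) - a → v ∈ S)
    (hcount : 4 * (a + 1) * (32 * b + 1) ≤ boxCount S (x₀, (p + b + 1 : ℤ)) b) :
    1 ≤ earlyPotential N δ a b x₀ p j S := by
  rw [earlyPotential, if_pos hj, expPotential]
  refine Real.one_le_exp ?_
  have h1 := le_sum_smearedPoisson (x₀ := x₀) hb hS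
  have hR := varBudget_nonneg (N := N) (θ := δ) (σ := fun q => oscBound N ((p + b : ℤ) - q))
    (fun q => oscBound_nonneg N _) hj
  have hN : (0 : ℝ) < N := by exact_mod_cast Nat.pos_of_ne_zero (NeZero.ne N)
  have h2 : (j : ℝ) / N ≤ p + 1 := by
    rw [div_le_iff₀ hN]
    have : (j : ℝ) ≤ ((N * (p + 1) : ℕ) : ℝ) := by exact_mod_cast hj
    push_cast at this
    linarith
  have h3 : 2 * ((a : ℝ) + 1) ≤
      boxCount S (x₀, (p + b + 1 : ℤ)) b * (1 / (2 * (32 * b + 1))) := by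
    rw [mul_one_div, le_div_iff₀ (by positivity)]
    have : ((4 * (a + 1) * (32 * b + 1) : ℕ) : ℝ) ≤ boxCount S (x₀, (p + b + 1 : ℤ)) b := by
      exact_mod_cast hcount
    push_cast at this
    linarith
  have h4 : (a : ℝ) + 1 ≤ ∑ v ∈ S, smearedPoisson (16 * b) (p + b + 1 + b) x₀ v - (j : ℝ) / N := by
    linarith
  have := mul_le_mul_of_nonneg_left h4 hδ0
  linarith

lemma earlyPotential_zero_le (hδ : 2 * δ ^ 2 ≤ 1) :
    earlyPotential N δ a b x₀ p 0 ∅ ≤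
      Real.exp (1 + Real.log N + 2 * δ ^ 2 * (a + b + 1) - δ * (a + 1)) := by
  rw [earlyPotential, if_pos (Nat.zero_le _), expPotential]
  refine Real.exp_le_exp.mpr ?_
  have := varBudget_oscBound_le (N := N) NeZero.one_le δ hδ (p + b)
    (a + b + 1) (p + 1) (by push_cast; omega)
  push_cast at this
  simp only [Finset.sum_empty, CharP.cast_eq_zero, zero_div, sub_zero, mul_zero]
  linarith

end Early

/-- The number of dyadic halvings used in the `i`-th annulus around a thin tentacle. -/
def halvings (Q i : ℕ) : ℕ := 7 + Q / 4 ^ i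

/-- The radius of the `i`-th box around the tip of a thin tentacle. -/
def annulusRadius (Q : ℕ) : ℕ → ℕ
  | 0 => 0
  | i + 1 => annulusRadius Q i + 2 * (halvings Q i * (16 * 2 ^ (i + 1))) + 1

lemma annulusRadius_mono (Q : ℕ) : Monotone (annulusRadius Q) :=
  monotone_nat_of_le_succ fun i => by rw [annulusRadius]; omega

lemma annulusRadius_le (Q : ℕ) (i : ℕ) :
    (annulusRadius Q i : ℝ) ≤ 449 * 2 ^ i + 128 * Q * (1 - (1 / 2) ^ i) := by
  induction i with
  | zero => norm_num [annulusRadius]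
  | succ i ih =>
    have h1 : ((Q / 4 ^ i : ℕ) : ℝ) ≤ Q / 4 ^ i := by
      have := @Nat.cast_div_le ℝ _ _ _ Q (4 ^ i)
      push_cast at this
      exact this
    have h2 : (Q : ℝ) / 4 ^ i * 2 ^ i = Q * (1 / 2) ^ i := by
      rw [show (4 : ℝ) = 2 * 2 by norm_num, mul_pow, one_div, inv_pow]
      field_simp
    have h3 : ((Q / 4 ^ i : ℕ) : ℝ) * 2 ^ i ≤ Q * (1 / 2) ^ i := by
      rw [← h2]
      gcongr
    have h4 : (1 : ℝ) ≤ 2 ^ i := one_le_pow₀ (by norm_num)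
    rw [annulusRadius, halvings]
    push_cast
    rw [pow_succ, pow_succ]
    nlinarith

lemma annulusRadius_log_le (I : ℕ) : annulusRadius (2 ^ I) I ≤ 1024 * 2 ^ I := by
  have h := annulusRadius_le (2 ^ I) I
  have h1 : (0 : ℝ) ≤ (1 / 2) ^ I := by positivity
  have h2 : (0 : ℝ) ≤ 2 ^ I := by positivity
  push_cast at h
  have : (annulusRadius (2 ^ I) I : ℝ) ≤ ((1024 * 2 ^ I : ℕ) : ℝ) := by
    push_cast
    nlinarith [mul_nonneg h2 h1]
  exact_mod_cast this

section Tentacle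

variable {N : ℕ} {S : Finset (ZMod N × ℤ)} {z : ZMod N × ℤ}

open Classical in
lemma boxCount_insert {y : ZMod N × ℤ} (hy : y ∉ S) (z : ZMod N × ℤ) (r : ℕ) :
    boxCount (insert y S) z r = boxCount S z r + if y ∈ cylBox z r then 1 else 0 := by
  rw [boxCount, boxCount, Finset.filter_insert]
  split_ifs with h
  · rw [Finset.card_insert_of_notMem fun hc => hy (Finset.mem_filter.mp hc).1]
  · rfl

lemma boxCount_mono {a b : ℕ} (h : a ≤ b) : boxCount S z a ≤ boxCount S z b := by
  classical
  exact Finset.card_le_card (Finset.monotone_filter_right S fun _ _ hv => cylBox_mono h hv)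

lemma one_le_boxCount (hz : z ∈ S) : 1 ≤ boxCount S z 0 := by
  classical
  exact Finset.card_pos.mpr ⟨z, Finset.mem_filter.mpr ⟨hz, mem_cylBox_self z 0⟩⟩

/-- Potential detecting a thin tentacle around `z` at scale `i`. -/
noncomputable def tentaclePotential (Q : ℕ) (z : ZMod N × ℤ) (i : ℕ)
    (S : Finset (ZMod N × ℤ)) : ℝ :=
  if boxCount S z (annulusRadius Q (i + 1)) ≤ 4 ^ (i + 1) then
    (2 ^ (halvings Q i - 1)) ^ boxCount S z (annulusRadius Q i) *
      (1 / 2) ^ boxCount S z (annulusRadius Q (i + 1)) * (1 / 2) ^ Q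
  else 0

lemma tentaclePotential_nonneg (Q : ℕ) (z : ZMod N × ℤ) (i : ℕ) (S : Finset (ZMod N × ℤ)) :
    0 ≤ tentaclePotential Q z i S := by
  rw [tentaclePotential]
  split_ifs
  · positivity
  · exact le_rfl

lemma tentaclePotential_empty_le (Q : ℕ) (z : ZMod N × ℤ) (i : ℕ) :
    tentaclePotential Q z i ∅ ≤ (1 / 2) ^ Q := by
  rw [tentaclePotential]
  split_ifs
  · simp [boxCount]
  · positivity

lemma startMean_tentaclePotential_le [NeZero N] {Q i : ℕ} (hN : 32 * 2 ^ (i + 1) + 1 ≤ N)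
    (hz : (annulusRadius Q (i + 1) : ℤ) < z.2) :
    startMean S (fun y => tentaclePotential Q z i (insert y S)) ≤ tentaclePotential Q z i S := by
  classical
  have hN3 : 3 ≤ N := by
    have := Nat.one_le_two_pow (n := i + 1)
    omega
  set r := annulusRadius Q i with hr
  set r' := annulusRadius Q (i + 1) with hr'
  have hr'eq : r' = r + 2 * (halvings Q i * (16 * 2 ^ (i + 1))) + 1 := by
    rw [hr', annulusRadius]
  have hrr : r ≤ r' := annulusRadius_mono Q (Nat.le_succ i)
  by_cases hc : boxCount S z r' ≤ 4 ^ (i + 1)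
  · set B : ℝ := 2 ^ (halvings Q i - 1) with hB
    have hB2 : 2 ≤ B := by
      have : (2 : ℝ) ^ 1 ≤ 2 ^ (halvings Q i - 1) :=
        pow_le_pow_right₀ (by norm_num) (by
          have : 7 ≤ halvings Q i := Nat.le_add_right _ _
          omega)
      simpa using this
    set φ : ZMod N × ℤ → ℝ := fun y => if y ∈ cylBox z r then -(B - 2) else
      if y ∈ cylBox z r' then 1 else 0 with hφ
    have hle : ∀ y ∈ clusterBdry S, tentaclePotential Q z i (insert y S) ≤
        tentaclePotential Q z i S + (-(tentaclePotential Q z i S / 2)) * φ y := by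
      intro y hy
      have hyS := notMem_of_mem_clusterBdry hy
      have hU : tentaclePotential Q z i S =
          B ^ boxCount S z r * (1 / 2) ^ boxCount S z r' * (1 / 2) ^ Q := by
        rw [tentaclePotential, if_pos hc]
      have hstep : tentaclePotential Q z i (insert y S) ≤
          B ^ boxCount (insert y S) z r * (1 / 2) ^ boxCount (insert y S) z r' * (1 / 2) ^ Q := by
        rw [tentaclePotential]
        split_ifs
        · exact le_rfl
        · positivity
      refine hstep.trans (le_of_eq ?_)
      rw [hU, boxCount_insert hyS, boxCount_insert hyS]
      simp only [hφ]
      by_cases h1 : y ∈ cylBox z r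
      · rw [if_pos h1, if_pos h1, if_pos (cylBox_mono hrr h1), pow_succ, pow_succ]
        ring
      · rw [if_neg h1, if_neg h1]
        by_cases h2 : y ∈ cylBox z r'
        · rw [if_pos h2, if_pos h2, pow_succ]
          ring
        · rw [if_neg h2, if_neg h2]
          ring
    refine (startMean_mono hN3 hle).trans ?_
    rw [startMean_add, startMean_const hN3, startMean_const_mul]
    have hφ0 : 0 ≤ startMean S φ := by
      refine startMean_annulus_sub_nonneg (ν := 2 ^ (i + 1)) (s := halvings Q i) (z := z)
        (r := r) (K := B - 2) (by positivity) hN (by linarith) ?_ (by rwa [← hr'eq]) ?_ ?_ ?_ ?_ ?_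
      · have : B ≤ 2 ^ halvings Q i := pow_le_pow_right₀ (by norm_num) (by omega)
        linarith
      · rw [← hr'eq, ← pow_mul, mul_comm (i + 1) 2, pow_mul]
        exact hc
      · intro v hv
        simp only [hφ, if_pos hv]
      · intro v hv
        simp only [hφ, if_neg hv]
        split_ifs <;> norm_num
      · intro v hv hv'
        rw [← hr'eq] at hv
        simp only [hφ, if_neg hv', if_pos hv]
      · intro v
        simp only [hφ]
        split_ifs <;> linarith
    have := mul_nonneg (div_nonneg (tentaclePotential_nonneg Q z i S) zero_le_two) hφ0
    linarith
  · have h0 : ∀ y ∈ clusterBdry S, tentaclePotential Q z i (insert y S) ≤ 0 := by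
      intro y hy
      rw [tentaclePotential, if_neg]
      rw [boxCount_insert (notMem_of_mem_clusterBdry hy)]
      exact fun hle => hc ((Nat.le_add_right _ _).trans hle)
    refine (startMean_mono hN3 h0).trans ?_
    rw [startMean_const hN3]
    exact tentaclePotential_nonneg Q z i S

lemma one_le_tentaclePotential {Q i : ℕ} (h1 : 4 ^ i ≤ boxCount S z (annulusRadius Q i))
    (h2 : boxCount S z (annulusRadius Q (i + 1)) ≤ 4 ^ (i + 1)) :
    1 ≤ tentaclePotential Q z i S := by
  rw [tentaclePotential, if_pos h2]
  have hQ : Q < 4 ^ i * (Q / 4 ^ i + 1) := Nat.lt_mul_div_succ Q (by positivity)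
  have hexp : boxCount S z (annulusRadius Q (i + 1)) + Q ≤
      (halvings Q i - 1) * boxCount S z (annulusRadius Q i) := by
    have h3 : (halvings Q i - 1) * 4 ^ i ≤
        (halvings Q i - 1) * boxCount S z (annulusRadius Q i) := Nat.mul_le_mul_left _ h1
    have h4 : halvings Q i - 1 = Q / 4 ^ i + 6 := by rw [halvings, add_comm]; rfl
    rw [h4] at h3 ⊢
    rw [pow_succ] at h2
    nlinarith
  rw [mul_assoc, ← pow_add, ← pow_mul, one_div, inv_pow, ← div_eq_mul_inv, le_div_iff₀ (by positivity),
    one_mul]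
  exact pow_le_pow_right₀ (by norm_num) hexp

lemma pow_le_boxCount_of_tentaclePotential_lt {Q I : ℕ} (hz : z ∈ S)
    (h : ∀ i < I, tentaclePotential Q z i S < 1) :
    4 ^ I ≤ boxCount S z (annulusRadius Q I) := by
  induction I with
  | zero => exact one_le_boxCount hz
  | succ I ih =>
    by_contra hc
    push Not at hc
    exact absurd (one_le_tentaclePotential (ih fun i hi => h i (by omega)) hc.le)
      (not_le.mpr (h I (Nat.lt_succ_self I)))

end Tentacle

section Family

variable {N : ℕ} [NeZero N] {δ : ℝ} {a b : ℕ}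

/-- All potentials detecting a deviation at column `α.1`, height `α.2.1` and scale `α.2.2`. -/
noncomputable def deviationPotential (N : ℕ) [NeZero N] (δ : ℝ) (a b Q : ℕ)
    (α : ZMod N × ℕ × ℕ) (j : ℕ) (S : Finset (ZMod N × ℤ)) : ℝ :=
  match α.2.2 with
  | 0 => latePotential N δ a b α.1 α.2.1 j S
  | 1 => earlyPotential N δ a b α.1 α.2.1 j S
  | i + 2 => tentaclePotential Q (α.1, (α.2.1 + b + 1 : ℤ)) i S

lemma deviationPotential_nonneg (Q : ℕ) (α : ZMod N × ℕ × ℕ) (j : ℕ) (S : Finset (ZMod N × ℤ)) :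
    0 ≤ deviationPotential N δ a b Q α j S := by
  obtain ⟨x, k, i⟩ := α
  match i with
  | 0 => exact latePotential_nonneg S
  | 1 => exact earlyPotential_nonneg S
  | i + 2 => exact tentaclePotential_nonneg _ _ _ S

lemma deviationPotential_zero_le {Q : ℕ} {c : ℝ} (hδ : 2 * δ ^ 2 ≤ 1)
    (hc : Real.exp (1 + Real.log N + 2 * δ ^ 2 * (a + b + 1) - δ * (a + 1)) ≤ c)
    (hQ : (1 / 2) ^ Q ≤ c) (α : ZMod N × ℕ × ℕ) : deviationPotential N δ a b Q α 0 ∅ ≤ c := by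
  obtain ⟨x, k, i⟩ := α
  match i with
  | 0 => exact (latePotential_zero_le hδ).trans hc
  | 1 => exact (earlyPotential_zero_le hδ).trans hc
  | i + 2 => exact (tentaclePotential_empty_le _ _ _).trans hQ

variable {I : ℕ}

lemma startMean_deviationPotential_le (hδ0 : 0 ≤ δ) (hδ1 : δ ≤ 1) (hN : 32 * 2 ^ I + 1 ≤ N)
    (hb : annulusRadius (2 ^ I) I ≤ b) {α : ZMod N × ℕ × ℕ} (hα : α.2.2 < I + 2) {j : ℕ}
    {S : Finset (ZMod N × ℤ)} (h : NearRect a b j S) :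
    startMean S (fun y => deviationPotential N δ a b (2 ^ I) α (j + 1) (insert y S)) ≤
      deviationPotential N δ a b (2 ^ I) α j S := by
  have hN3 : 3 ≤ N := by
    have := Nat.one_le_two_pow (n := I)
    omega
  obtain ⟨x, k, i⟩ := α
  match i with
  | 0 => exact startMean_latePotential_le hN3 hδ0 hδ1 h
  | 1 => exact startMean_earlyPotential_le hN3 hδ0 hδ1 h
  | i + 2 =>
    have hi : i + 1 ≤ I := by
      simp only at hα
      omega
    refine startMean_tentaclePotential_le ?_ ?_
    · have : 2 ^ (i + 1) ≤ 2 ^ I := Nat.pow_le_pow_right (by norm_num) hi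
      omega
    · have := annulusRadius_mono (2 ^ I) hi
      simp only
      omega

lemma exists_one_le_deviationPotential (hδ0 : 0 ≤ δ) (hb0 : 0 < b)
    (hb : annulusRadius (2 ^ I) I ≤ b) (hcount : 4 * (a + 1) * (32 * b + 1) ≤ 4 ^ I) {j B : ℕ}
    (hj : j + 1 ≤ B) {S : Finset (ZMod N × ℤ)} (hS : ∀ v ∈ S, 1 ≤ v.2) (h : NearRect a b j S)
    {y : ZMod N × ℤ} (hy : y ∈ clusterBdry S) (hbad : ¬ NearRect a b (j + 1) (insert y S)) :
    ∃ α ∈ (Finset.univ : Finset (ZMod N)) ×ˢ Finset.range (B + 1) ×ˢ Finset.range (I + 2),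
      1 ≤ deviationPotential N δ a b (2 ^ I) α (j + 1) (insert y S) := by
  have hN0 : 0 < N := Nat.pos_of_ne_zero (NeZero.ne N)
  rcases late_or_early_of_not_nearRect hS h hy hbad with
    ⟨x₀, k, hk, hjk, hz⟩ | ⟨x₀, p, hp', hp, rfl⟩
  · refine ⟨(x₀, k, 0), ?_, ?_⟩
    · simp only [Finset.mem_product, Finset.mem_univ, Finset.mem_range, true_and]
      refine ⟨?_, by omega⟩
      have : k + a ≤ N * (k + a) := Nat.le_mul_of_pos_left _ hN0
      omega
    · change 1 ≤ latePotential N δ a b x₀ k (j + 1) _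
      rw [hjk]
      exact one_le_latePotential hδ0 hk (insert_pos hS hy) hz
  · have hpB : p < B + 1 := by
      have := Nat.div_le_self j N
      omega
    by_contra hc
    push Not at hc
    have htent : ∀ i < I, tentaclePotential (2 ^ I) (x₀, (p + b + 1 : ℤ)) i
        (insert (x₀, (p + b + 1 : ℤ)) S) < 1 := by
      intro i hi
      exact hc (x₀, p, i + 2) (by
        simp only [Finset.mem_product, Finset.mem_univ, Finset.mem_range, true_and]
        omega)
    have hcard := (pow_le_boxCount_of_tentaclePotential_lt (Finset.mem_insert_self _ _)
      htent).trans (boxCount_mono hb)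
    have hearly : earlyPotential N δ a b x₀ p (j + 1) (insert (x₀, (p + b + 1 : ℤ)) S) < 1 :=
      hc (x₀, p, 1) (by
        simp only [Finset.mem_product, Finset.mem_univ, Finset.mem_range, true_and]
        omega)
    refine absurd (one_le_earlyPotential hδ0 hb0 ?_ ?_ (hcount.trans hcard)) (not_le.mpr hearly)
    · have := Nat.lt_mul_div_succ (j + 1) hN0
      rw [hp'] at this
      exact this.le
    · intro v hv1 hv
      rw [← hp] at hv
      exact Finset.mem_insert_of_mem (mem_of_mem_cluster (h.1 v hv) hv1)

end Family

theorem measure_not_nearRect_le {N : ℕ} [NeZero N] {Ω : Type} {C : ℕ → Ω → Set (ZMod N × ℤ)}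
    {Y : ℕ → Ω → ZMod N × ℤ} [MeasurableSpace Ω] (P : Measure Ω)
    [IsProbabilityMeasure P] (hC0 : ∀ ω, C 0 ω = cylRect N 0)
    (hstep : ∀ n ω, C (n + 1) ω = insert (Y (n + 1) ω) (C n ω))
    (hY : ∀ n ω, Y (n + 1) ω ∈ bdryS cylNbrZ (C n ω))
    (hlaw : ∀ (n : ℕ) (A : Set (ZMod N × ℤ)), ∀ y ∈ bdryS cylNbrZ A,
        P {ω | C n ω = A ∧ Y (n + 1) ω = y}
          = ENNReal.ofReal
              ((N : ℝ)⁻¹ * ∑ j ∈ Finset.range N,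
                hitMeas cylNbrZ (bdryS cylNbrZ A) ((j : ZMod N), 0) y) *
            P {ω | C n ω = A})
    {δ c : ℝ} {a b I : ℕ} (hδ0 : 0 ≤ δ) (hδ1 : δ ≤ 1) (hδ : 2 * δ ^ 2 ≤ 1)
    (hN : 32 * 2 ^ I + 1 ≤ N) (hb0 : 0 < b) (hb : annulusRadius (2 ^ I) I ≤ b)
    (hcount : 4 * (a + 1) * (32 * b + 1) ≤ 4 ^ I)
    (hc : Real.exp (1 + Real.log N + 2 * δ ^ 2 * (a + b + 1) - δ * (a + 1)) ≤ c)
    (hQ : (1 / 2) ^ 2 ^ I ≤ c) {n B : ℕ} (hn : n ≤ B) :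
    P {ω | ∃ S : Finset (ZMod N × ℤ), (∀ v ∈ S, 1 ≤ v.2) ∧ C n ω = cluster S ∧
        ¬ NearRect a b n S} ≤ ENNReal.ofReal ((N * ((B + 1) * (I + 2)) : ℕ) * c) := by
  classical
  have hN3 : 3 ≤ N := by
    have := Nat.one_le_two_pow (n := I)
    omega
  set A := (Finset.univ : Finset (ZMod N)) ×ˢ Finset.range (B + 1) ×ˢ Finset.range (I + 2) with hA
  set U : ℕ → Finset (ZMod N × ℤ) → ℝ :=
    fun j S => ∑ α ∈ A, deviationPotential N δ a b (2 ^ I) α j S with hU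
  have hU0 : ∀ j S, 0 ≤ U j S := fun j S =>
    Finset.sum_nonneg fun α _ => deviationPotential_nonneg _ α j S
  set V : ℕ → Finset (ZMod N × ℤ) → ℝ :=
    fun j S => if NearRect a b j S then min 1 (U j S) else 1 with hV
  have hV0 : ∀ j S, 0 ≤ V j S := by
    intro j S
    simp only [hV]
    split_ifs
    · exact le_min zero_le_one (hU0 j S)
    · exact zero_le_one
  have hV1 : ∀ j S, V j S ≤ 1 := by
    intro j S
    simp only [hV]
    split_ifs
    · exact min_le_left _ _
    · exact le_rfl
  have hVstep : ∀ j < n, ∀ S : Finset (ZMod N × ℤ), (∀ v ∈ S, 1 ≤ v.2) →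
      startMean S (fun y => V (j + 1) (insert y S)) ≤ V j S := by
    intro j hj S hS
    have h1 : startMean S (fun y => V (j + 1) (insert y S)) ≤ 1 :=
      (startMean_mono hN3 fun y _ => hV1 _ _).trans (startMean_const hN3 1).le
    by_cases hgood : NearRect a b j S
    swap
    · simp only [hV, if_neg hgood] at h1 ⊢
      exact h1
    have hVj : V j S = min 1 (U j S) := by simp only [hV, if_pos hgood]
    rw [hVj]
    refine le_min h1 ?_
    have hle : ∀ y ∈ clusterBdry S, V (j + 1) (insert y S) ≤ U (j + 1) (insert y S) := by
      intro y hy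
      by_cases hg : NearRect a b (j + 1) (insert y S)
      · simp only [hV, if_pos hg]
        exact min_le_right _ _
      · simp only [hV, if_neg hg]
        obtain ⟨α, hα, hα1⟩ := exists_one_le_deviationPotential (N := N) hδ0 hb0 hb hcount
          (by omega : j + 1 ≤ B) hS hgood hy hg
        exact hα1.trans (Finset.single_le_sum
          (f := fun α => deviationPotential N δ a b (2 ^ I) α (j + 1) (insert y S))
          (fun α _ => deviationPotential_nonneg _ α _ _) hα)
    refine (startMean_mono hN3 hle).trans ?_
    simp only [hU]
    rw [startMean_sum A fun α y => deviationPotential N δ a b (2 ^ I) α (j + 1) (insert y S)]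
    refine Finset.sum_le_sum fun α hα => ?_
    refine startMean_deviationPotential_le hδ0 hδ1 hN hb ?_ hgood
    exact Finset.mem_range.mp (Finset.mem_product.mp (Finset.mem_product.mp hα).2).2
  have hmain := measure_one_le_potential_le P hC0 hstep hY hlaw hN3 hV0 hVstep
  refine (measure_mono ?_).trans (hmain.trans (ENNReal.ofReal_le_ofReal ?_))
  · rintro ω ⟨S, hS, hCS, hbad⟩
    refine ⟨S, hS, hCS, ?_⟩
    simp only [hV, if_neg hbad]
    exact le_rfl
  · simp only [hV, if_pos (nearRect_zero a b)]
    refine (min_le_right _ _).trans ?_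
    simp only [hU]
    refine (Finset.sum_le_card_nsmul A _ c fun α _ =>
      deviationPotential_zero_le hδ hc hQ α).trans (le_of_eq ?_)
    rw [nsmul_eq_mul, hA, Finset.card_product, Finset.card_product, Finset.card_univ, ZMod.card,
      Finset.card_range, Finset.card_range]

lemma NearRect.cylRect_subset {N : ℕ} [NeZero N] {a b n : ℕ} {S : Finset (ZMod N × ℤ)}
    (h : NearRect a b n S) {t : ℝ} (ha : (a : ℝ) + 1 ≤ t) (hb : (b : ℝ) ≤ t) :
    cylRect N ((n : ℝ) / N - t) ⊆ cluster S ∧ cluster S ⊆ cylRect N ((n : ℝ) / N + t) := by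
  have hN : 0 < N := Nat.pos_of_ne_zero (NeZero.ne N)
  have hNR : (0 : ℝ) < N := by exact_mod_cast hN
  have hlow : ((n / N : ℕ) : ℝ) ≤ (n : ℝ) / N := Nat.cast_div_le
  have hup : (n : ℝ) / N < ((n / N : ℕ) : ℝ) + 1 := by
    rw [div_lt_iff₀ hNR]
    have : (n : ℝ) < ((N * (n / N + 1) : ℕ) : ℝ) := by
      exact_mod_cast Nat.lt_mul_div_succ n hN
    push_cast at this ⊢
    linarith
  constructor
  · intro v hv
    have hv' : (v.2 : ℝ) ≤ (n : ℝ) / N - t := hv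
    refine h.1 v ?_
    have : (v.2 : ℝ) ≤ ((((n / N : ℕ) : ℤ) - a : ℤ) : ℝ) := by
      rw [Int.cast_sub, Int.cast_natCast, Int.cast_natCast]
      linarith
    exact_mod_cast this
  · intro v hv
    have h1 := h.cluster_le hv
    have h2 : (v.2 : ℝ) ≤ ((((n / N : ℕ) : ℤ) + b : ℤ) : ℝ) := by exact_mod_cast h1
    rw [Int.cast_add, Int.cast_natCast, Int.cast_natCast] at h2
    change (v.2 : ℝ) ≤ (n : ℝ) / N + t
    linarith

lemma half_pow_le_exp (n : ℕ) : (1 / 2 : ℝ) ^ n ≤ Real.exp (-(n / 2)) := by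
  have h : (1 / 2 : ℝ) ≤ Real.exp (-(1 / 2)) := by
    have := Real.add_one_le_exp (-(1 / 2) : ℝ)
    linarith
  calc (1 / 2 : ℝ) ^ n ≤ Real.exp (-(1 / 2)) ^ n := pow_le_pow_left₀ (by norm_num) h n
    _ = Real.exp (-(n / 2)) := by
      rw [← Real.exp_nat_mul]
      congr 1
      ring

/-- A dyadic scale comparable to a multiple of `log N`. -/
lemma exists_dyadic_scale {K : ℝ} (hK : 1 ≤ K) : ∃ N₀ : ℕ, ∀ N : ℕ, N₀ ≤ N →
    3 ≤ N ∧ 1 ≤ Real.log N ∧ ∃ g : ℕ, K * Real.log N ≤ 2 ^ g ∧ (2 : ℝ) ^ g ≤ 2 * (K * Real.log N) ∧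
      32 * 2 ^ (g + 18) + 1 ≤ N := by
  have hlim : Tendsto (fun N : ℕ => Real.log N) atTop atTop :=
    Real.tendsto_log_atTop.comp tendsto_natCast_atTop_atTop
  have hlo : ∀ᶠ N : ℕ in atTop, ‖Real.log N‖ ≤ (2 ^ 25 * K)⁻¹ * ‖(N : ℝ)‖ :=
    tendsto_natCast_atTop_atTop.eventually
      (Real.isLittleO_log_id_atTop.def (by positivity : (0 : ℝ) < (2 ^ 25 * K)⁻¹))
  obtain ⟨N₀, hN₀⟩ := eventually_atTop.mp
    ((eventually_ge_atTop 3).and ((hlim.eventually_ge_atTop 1).and hlo))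
  refine ⟨N₀, fun N hN => ?_⟩
  obtain ⟨h3, hlog, hl⟩ := hN₀ N hN
  refine ⟨h3, hlog, ?_⟩
  have hx : 1 ≤ K * Real.log N := one_le_mul_of_one_le_of_one_le hK hlog
  obtain ⟨g, hg1, hg2⟩ := exists_nat_pow_near hx (one_lt_two : (1 : ℝ) < 2)
  refine ⟨g + 1, hg2.le, ?_, ?_⟩
  · rw [pow_succ]
    linarith
  · rw [Real.norm_of_nonneg (by linarith), Real.norm_of_nonneg (by positivity),
      inv_mul_eq_div, le_div_iff₀ (by positivity)] at hl
    have : ((32 * 2 ^ (g + 1 + 18) + 1 : ℕ) : ℝ) ≤ N := by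
      push_cast
      rw [show (2 : ℝ) ^ (g + 1 + 18) = 2 ^ 19 * 2 ^ g by ring]
      nlinarith
    exact_mod_cast this

lemma union_bound_le {N m g : ℕ} {γ : ℝ} (hN3 : 3 ≤ N) (hlog : 1 ≤ Real.log N)
    (hg : 2 ^ 32 * (γ + 2 * m + 7) * Real.log N ≤ 2 ^ g) (hgN : 32 * 2 ^ (g + 18) + 1 ≤ N) :
    ((N ^ m + 1 : ℕ) : ℝ) * ((N * ((N ^ m + 1) * (g + 18 + 2)) : ℕ) *
      Real.exp (1 + Real.log N - 2 ^ g / 2 ^ 32)) ≤ (N : ℝ) ^ (-γ) := by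
  have hN0 : (0 : ℝ) < N := by positivity
  have h1 : N ^ m + 1 ≤ N ^ (m + 1) := by
    have := Nat.one_le_pow m N (by omega)
    rw [pow_succ]
    nlinarith
  have h2 : g + 18 + 2 ≤ N := by
    have := Nat.lt_two_pow_self (n := g + 18)
    omega
  have h3 : (N ^ m + 1) * (N * ((N ^ m + 1) * (g + 18 + 2))) ≤ N ^ (2 * m + 4) := by
    calc _ ≤ N ^ (m + 1) * (N * (N ^ (m + 1) * N)) := by gcongr
      _ = N ^ (2 * m + 4) := by ring
  have h4 : ((N ^ m + 1 : ℕ) : ℝ) * ((N * ((N ^ m + 1) * (g + 18 + 2)) : ℕ) : ℝ) ≤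
      Real.exp (Real.log N * (2 * m + 4)) := by
    have : Real.exp (Real.log N * (2 * m + 4)) = ((N ^ (2 * m + 4) : ℕ) : ℝ) := by
      rw [← Real.rpow_def_of_pos hN0]
      push_cast
      rw [← Real.rpow_natCast]
      push_cast
      rfl
    rw [this, ← Nat.cast_mul]
    exact_mod_cast h3
  rw [← mul_assoc]
  refine (mul_le_mul_of_nonneg_right h4 (Real.exp_pos _).le).trans ?_
  rw [← Real.exp_add, Real.rpow_def_of_pos hN0]
  refine Real.exp_le_exp.mpr ?_
  have h5 : (γ + 2 * m + 7) * Real.log N ≤ 2 ^ g / 2 ^ 32 := by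
    rw [le_div_iff₀ (by positivity)]
    linarith
  nlinarith

lemma one_sub_le_measure_of_compl_le {Ω : Type*} [MeasurableSpace Ω] (P : Measure Ω)
    [IsProbabilityMeasure P] {A : Set Ω} {ε : ENNReal} (h : P Aᶜ ≤ ε) : 1 - ε ≤ P A := by
  rw [tsub_le_iff_right, ← measure_univ (μ := P), ← Set.union_compl_self A]
  exact (measure_union_le _ _).trans (by gcongr)

/-- **Internal DLA on the cylinder `ℤ_N × ℤ` (Levine–Silvestri, generalizing
Jerison–Levine–Sheffield).**  For any `γ > 0` and `m ∈ ℕ` there is `C = C(γ,m)` such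
that for `N` large enough, with probability at least `1 - N^{-γ}` the cluster stays
within `C log N` of the rectangle `R_{n/N}` for all `n ≤ N^m`. -/
theorem internal_dla_cylinder_rectangles (γ : ℝ) (hγ : 0 < γ) (m : ℕ) :
    ∃ C : ℝ, ∃ N₀ : ℕ, ∀ N : ℕ, N₀ ≤ N →
    ∀ (Ω : Type) [MeasurableSpace Ω] (P : Measure Ω), IsProbabilityMeasure P →
    ∀ (I : ℕ → Ω → Set (ZMod N × ℤ)) (Y : ℕ → Ω → ZMod N × ℤ),
      -- the process starts from the rectangle `R₀`
      (∀ ω, I 0 ω = cylRect N 0) →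
      (∀ n ω, I (n+1) ω = insert (Y (n+1) ω) (I n ω)) →
      (∀ n ω, Y (n+1) ω ∈ bdryS cylNbrZ (I n ω)) →
      -- `Y (n+1)` is the first exit location from `I n` of a simple random walk started
      -- at a uniformly random site of level zero, independent of the past
      (∀ (n : ℕ) (A : Set (ZMod N × ℤ)), ∀ y ∈ bdryS cylNbrZ A,
        P {ω | I n ω = A ∧ Y (n+1) ω = y}
          = ENNReal.ofReal
              ((N : ℝ)⁻¹ * ∑ j ∈ Finset.range N,
                hitMeas cylNbrZ (bdryS cylNbrZ A) ((j : ZMod N), 0) y) *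
            P {ω | I n ω = A}) →
      P {ω | ∀ n : ℕ, n ≤ N ^ m →
          cylRect N ((n : ℝ) / N - C * Real.log N) ⊆ I n ω ∧
          I n ω ⊆ cylRect N ((n : ℝ) / N + C * Real.log N)}
        ≥ 1 - (N : ENNReal) ^ (-γ) := by
  set K : ℝ := 2 ^ 32 * (γ + 2 * m + 7) with hK
  have hK1 : 1 ≤ K := by
    have : (0 : ℝ) ≤ m := Nat.cast_nonneg m
    rw [hK]
    nlinarith
  obtain ⟨N₀, hN₀⟩ := exists_dyadic_scale hK1
  refine ⟨2 ^ 30 * K, N₀, fun N hN Ω _ P hP I Y hI0 hstep hY hlaw => ?_⟩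
  obtain ⟨hN3, hlog, g, hg1, hg2, hgN⟩ := hN₀ N hN
  have : NeZero N := ⟨by omega⟩
  have h2g : (1 : ℝ) ≤ 2 ^ g := one_le_pow₀ (by norm_num)
  have ha : ((2 ^ g - 1 : ℕ) : ℝ) + 1 = 2 ^ g := by
    rw [Nat.cast_sub Nat.one_le_two_pow]
    push_cast
    ring
  set c : ℝ := Real.exp (1 + Real.log N - 2 ^ g / 2 ^ 32) with hc
  set bad : ℕ → Set Ω := fun n => {ω | ∃ S : Finset (ZMod N × ℤ), (∀ v ∈ S, 1 ≤ v.2) ∧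
    I n ω = cluster S ∧ ¬ NearRect (2 ^ g - 1) (1024 * 2 ^ (g + 18)) n S} with hbad
  have hbadle : ∀ n ∈ Finset.range (N ^ m + 1), P (bad n) ≤
      ENNReal.ofReal ((N * ((N ^ m + 1) * (g + 18 + 2)) : ℕ) * c) := by
    intro n hn
    refine measure_not_nearRect_le P hI0 hstep hY hlaw (δ := 1 / 2 ^ 31) (by positivity)
      (by norm_num) (by norm_num) hgN (by positivity) (annulusRadius_log_le _) ?_ ?_ ?_
      (Nat.lt_succ_iff.mp (Finset.mem_range.mp hn))
    · rw [Nat.sub_add_cancel Nat.one_le_two_pow]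
      have h1 : 1 ≤ 2 ^ g := Nat.one_le_two_pow
      have h2 : 4 ^ (g + 18) = 2 ^ 36 * (2 ^ g * 2 ^ g) := by
        rw [show 4 = 2 * 2 from rfl, mul_pow, pow_add]
        ring
      rw [h2, pow_add]
      nlinarith
    · refine Real.exp_le_exp.mpr ?_
      push_cast
      have : (((2 ^ g - 1 : ℕ) : ℝ) + 1024 * 2 ^ (g + 18) + 1) = 2 ^ g + 2 ^ 28 * 2 ^ g := by
        rw [add_right_comm, ha]
        ring
      rw [this, ha]
      ring_nf
      linarith
    · refine (half_pow_le_exp _).trans (Real.exp_le_exp.mpr ?_)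
      push_cast
      rw [pow_add]
      linarith
  have hcompl : {ω | ∀ n : ℕ, n ≤ N ^ m →
      cylRect N ((n : ℝ) / N - 2 ^ 30 * K * Real.log N) ⊆ I n ω ∧
      I n ω ⊆ cylRect N ((n : ℝ) / N + 2 ^ 30 * K * Real.log N)}ᶜ ⊆
        ⋃ n ∈ Finset.range (N ^ m + 1), bad n := by
    intro ω hω
    rw [Set.mem_compl_iff, Set.mem_ofPred_eq] at hω
    push Not at hω
    obtain ⟨n, hn, hω⟩ := hω
    refine Set.mem_iUnion₂.mpr ⟨n, Finset.mem_range.mpr (by omega), ?_⟩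
    obtain ⟨S, hS, hIS⟩ := exists_eq_cluster hI0 hstep hY n ω
    refine ⟨S, hS, hIS, fun hnear => ?_⟩
    have := hnear.cylRect_subset (t := 2 ^ 30 * K * Real.log N) (by rw [ha]; linarith) (by
      push_cast
      rw [pow_add]
      linarith)
    rw [← hIS] at this
    exact hω this.1 this.2
  refine one_sub_le_measure_of_compl_le P ?_
  refine (measure_mono hcompl).trans ((measure_biUnion_finset_le _ _).trans ?_)
  refine (Finset.sum_le_card_nsmul _ _ _ hbadle).trans ?_
  rw [Finset.card_range, nsmul_eq_mul, ← ENNReal.ofReal_natCast (N ^ m + 1),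
    ← ENNReal.ofReal_mul (by positivity), ← ENNReal.ofReal_natCast N,
    ENNReal.ofReal_rpow_of_pos (by positivity)]
  exact ENNReal.ofReal_le_ofReal (union_bound_le hN3 hlog hg1 hgN)
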